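/- Let K be a field and let L be a subfield of K^solv containing K such that L is Galois (normal) over K. If O' is a solv-henselian valuation ring of L whose residue field is not solv-closed, then O' ∩ K is a solv-henselian valuation ring of K whose residue field is not solv-closed. -/

import Mathlib

noncomputable section

/-- The maximal solvable extension of `K` inside an ambient field extension `Ω`:
the compositum of all finite Galois subextensions of `Ω/K` with solvable Galois group. -/
def maxSolvableExt (K Ω : Type*) [Field K] [Field Ω] [Algebra K Ω] :
    IntermediateField K Ω :=
  ⨆ L : {L : IntermediateField K Ω //
      FiniteDimensional K ↥L ∧ IsGalois K ↥L ∧ IsSolvable (↥L ≃ₐ[K] ↥L)}, L.1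

/-- `K^solv`, the maximal solvable extension of `K` (inside a fixed algebraic closure). -/
abbrev solvClosure (K : Type*) [Field K] : IntermediateField K (AlgebraicClosure K) :=
  maxSolvableExt K (AlgebraicClosure K)

/-- A valuation (subring) of `K` is solv-henselian if it extends uniquely to `K^solv`. -/
def IsSolvHenselian {K : Type*} [Field K] (O : ValuationSubring K) : Prop :=
  ∃! O' : ValuationSubring ↥(solvClosure K),
    O'.comap (algebraMap K ↥(solvClosure K)) = O

/-- A field is solv-closed if it admits no nontrivial finite Galois extension with
solvable Galois group. -/
def IsSolvClosed (K : Type*) [Field K] : Prop :=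
  ∀ L : IntermediateField K (AlgebraicClosure K),
    FiniteDimensional K ↥L → IsGalois K ↥L → IsSolvable (↥L ≃ₐ[K] ↥L) → L = ⊥

open Polynomial

section SolvableExtensions

variable {K Ω : Type*} [Field K] [Field Ω] [Algebra K Ω]

/-- The finite Galois subextensions with solvable Galois group. -/
def IsFiniteSolvable (M : IntermediateField K Ω) : Prop :=
  FiniteDimensional K M ∧ IsGalois K M ∧ Group.IsSolvable Gal(M/K)

variable (K Ω) in
theorem maxSolvableExt_eq :
    maxSolvableExt K Ω = ⨆ M : {M : IntermediateField K Ω // IsFiniteSolvable M}, M.1 :=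
  rfl

theorem IsFiniteSolvable.le_maxSolvableExt {M : IntermediateField K Ω} (hM : IsFiniteSolvable M) :
    M ≤ maxSolvableExt K Ω :=
  le_iSup_of_le (f := fun M : {M : IntermediateField K Ω // IsFiniteSolvable M} => M.1)
    ⟨M, hM⟩ le_rfl

theorem isSolvable_gal_sup (M N : IntermediateField K Ω) [Normal K M] [Normal K N]
    (hM : Group.IsSolvable Gal(M/K)) (hN : Group.IsSolvable Gal(N/K)) :
    Group.IsSolvable Gal(↥(M ⊔ N)/K) := by
  let : Algebra M ↥(M ⊔ N) := (IntermediateField.inclusion le_sup_left).toAlgebra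
  let : Algebra N ↥(M ⊔ N) := (IntermediateField.inclusion le_sup_right).toAlgebra
  have : IsScalarTower K M ↥(M ⊔ N) := IsScalarTower.of_algebraMap_eq fun _ => rfl
  have : IsScalarTower K N ↥(M ⊔ N) := IsScalarTower.of_algebraMap_eq fun _ => rfl
  let f : Gal(↥(M ⊔ N)/K) →* Gal(M/K) × Gal(N/K) :=
    (AlgEquiv.restrictNormalHom M).prod (AlgEquiv.restrictNormalHom N)
  refine Group.isSolvable_of_isSolvable_injective (f := f) ?_
  rw [injective_iff_map_eq_one]
  intro σ hσ
  have h1 : AlgEquiv.restrictNormalHom M σ = 1 := congrArg Prod.fst hσ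
  have h2 : AlgEquiv.restrictNormalHom N σ = 1 := congrArg Prod.snd hσ
  have key : M ⊔ N ≤ (IntermediateField.fixedField (Subgroup.zpowers σ)).map
      (IntermediateField.val (M ⊔ N)) := by
    refine sup_le (fun x hx => ?_) (fun x hx => ?_)
    · refine ⟨⟨x, le_sup_left (a := M) hx⟩, ?_, rfl⟩
      have h := AlgEquiv.restrictNormal_commutes σ M ⟨x, hx⟩
      rw [show σ.restrictNormal M = 1 from h1] at h
      have : σ ∈ MulAction.stabilizer _ (⟨x, le_sup_left (a := M) hx⟩ : ↥(M ⊔ N)) := h.symm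
      rintro ⟨τ, hτ⟩
      exact (Subgroup.zpowers_le.2 this) hτ
    · refine ⟨⟨x, le_sup_right (a := M) hx⟩, ?_, rfl⟩
      have h := AlgEquiv.restrictNormal_commutes σ N ⟨x, hx⟩
      rw [show σ.restrictNormal N = 1 from h2] at h
      have : σ ∈ MulAction.stabilizer _ (⟨x, le_sup_right (a := M) hx⟩ : ↥(M ⊔ N)) := h.symm
      rintro ⟨τ, hτ⟩
      exact (Subgroup.zpowers_le.2 this) hτ
  ext ⟨x, hx⟩
  obtain ⟨y, hy, hxy⟩ := key hx
  have : y = ⟨x, hx⟩ := Subtype.ext hxy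
  subst this
  exact congrArg _ (hy ⟨σ, Subgroup.mem_zpowers σ⟩)

/-- Every element of the maximal solvable extension lies in a finite solvable Galois
subextension. -/
theorem exists_finite_of_mem_maxSolvableExt {x : Ω} (hx : x ∈ maxSolvableExt K Ω) :
    ∃ M : IntermediateField K Ω, IsFiniteSolvable M ∧ x ∈ M := by
  have hbot : IsFiniteSolvable (⊥ : IntermediateField K Ω) := by
    refine ⟨inferInstance, inferInstance, ?_⟩
    refine Group.isSolvable_of_comm fun σ τ => ?_
    have (ρ : Gal((⊥ : IntermediateField K Ω)/K)) : ρ = 1 := by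
      ext ⟨y, hy⟩
      obtain ⟨z, rfl⟩ := IntermediateField.mem_bot.1 hy
      exact congrArg Subtype.val (ρ.commutes z)
    rw [this σ, this τ]
  have : Nonempty {M : IntermediateField K Ω // IsFiniteSolvable M} := ⟨⟨⊥, hbot⟩⟩
  have hdir : Directed (· ≤ ·) fun L : {M : IntermediateField K Ω // IsFiniteSolvable M} => L.1 := by
    rintro ⟨M, h1, h2, h3⟩ ⟨N, h4, h5, h6⟩
    refine ⟨⟨M ⊔ N, IntermediateField.finiteDimensional_sup M N, ?_, isSolvable_gal_sup M N h3 h6⟩,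
      le_sup_left, le_sup_right⟩
    exact { to_isSeparable := inferInstance, to_normal := inferInstance }
  rw [maxSolvableExt_eq, ← SetLike.mem_coe, IntermediateField.coe_iSup_of_directed hdir,
    Set.mem_iUnion] at hx
  obtain ⟨⟨M, hM⟩, hxM⟩ := hx
  exact ⟨M, hM, hxM⟩

theorem isSolvable_gal_minpoly_of_normal {N : Type*} [Field N] [Algebra K N] [Normal K N]
    (hN : Group.IsSolvable Gal(N/K)) (x : N) : Group.IsSolvable (minpoly K x).Gal := by
  have : Fact (((minpoly K x).map (algebraMap K N)).Splits) := ⟨Normal.splits ‹_› x⟩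
  exact Group.isSolvable_of_surjective (Gal.restrict_surjective (minpoly K x) N)

theorem minpoly_intermediate {M : IntermediateField K Ω} (x : M) :
    minpoly K (x : Ω) = minpoly K x :=
  (minpoly.algHom_eq M.val M.val.injective x)

theorem isFiniteSolvable_adjoin_rootSet [IsAlgClosed Ω] {p : K[X]} (hsep : p.Separable)
    (hsol : Group.IsSolvable p.Gal) :
    IsFiniteSolvable (IntermediateField.adjoin K (p.rootSet Ω)) := by
  have := IntermediateField.adjoin_rootSet_isSplittingField
    (IsAlgClosed.splits (p.map (algebraMap K Ω)))
  refine ⟨IsSplittingField.finiteDimensional _ p, IsGalois.of_separable_splitting_field hsep, ?_⟩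
  have : Group.IsSolvable Gal(p.SplittingField/K) := hsol
  exact Group.isSolvable_of_isSolvable_injective
    (f := (IsSplittingField.algEquiv (IntermediateField.adjoin K (p.rootSet Ω)) p).autCongr.toMonoidHom)
    (MulEquiv.injective _) 

theorem mem_maxSolvableExt_iff [IsAlgClosed Ω] {x : Ω} :
    x ∈ maxSolvableExt K Ω ↔ IsSeparable K x ∧ Group.IsSolvable (minpoly K x).Gal := by
  constructor
  · intro hx
    obtain ⟨M, ⟨h1, h2, h3⟩, hxM⟩ := exists_finite_of_mem_maxSolvableExt hx
    rw [IsSeparable, minpoly_intermediate (⟨x, hxM⟩ : M)]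
    exact ⟨Algebra.IsSeparable.isSeparable K _, isSolvable_gal_minpoly_of_normal h3 _⟩
  · rintro ⟨hsep, hsol⟩
    have h := isFiniteSolvable_adjoin_rootSet (Ω := Ω) hsep hsol
    refine h.le_maxSolvableExt (IntermediateField.subset_adjoin _ _ ?_)
    rw [mem_rootSet]
    exact ⟨minpoly.ne_zero hsep.isIntegral, minpoly.aeval _ _⟩

instance isGalois_maxSolvableExt : IsGalois K (maxSolvableExt K Ω) :=
  { to_isSeparable := by
      rw [maxSolvableExt_eq]
      have (L : {M : IntermediateField K Ω // IsFiniteSolvable M}) :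
        Algebra.IsSeparable K L.1 := L.2.2.1.to_isSeparable
      infer_instance
    to_normal := by
      rw [maxSolvableExt_eq]
      have (L : {M : IntermediateField K Ω // IsFiniteSolvable M}) :
        Normal K L.1 := L.2.2.1.to_normal
      infer_instance }

/-- An element of an extension of a solv-closed field that is separable with solvable Galois
group already lies in the base field. -/
theorem IsSolvClosed.mem_range (hK : IsSolvClosed K) {x : Ω} (hsep : IsSeparable K x)
    (hsol : Group.IsSolvable (minpoly K x).Gal) : ∃ c, algebraMap K Ω c = x := by
  obtain ⟨h1, h2, h3⟩ := isFiniteSolvable_adjoin_rootSet (Ω := AlgebraicClosure K) hsep hsol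
  have h := hK _ h1 h2 h3
  obtain ⟨r, hr⟩ := IsAlgClosed.exists_aeval_eq_zero (AlgebraicClosure K) (minpoly K x)
    (minpoly.degree_pos hsep.isIntegral).ne'
  have hr' : r ∈ IntermediateField.adjoin K ((minpoly K x).rootSet (AlgebraicClosure K)) :=
    IntermediateField.subset_adjoin _ _ (mem_rootSet.2 ⟨minpoly.ne_zero hsep.isIntegral, hr⟩)
  rw [h, IntermediateField.mem_bot] at hr'
  obtain ⟨c, rfl⟩ := hr'
  rw [aeval_algebraMap_apply, map_eq_zero] at hr
  have := minpoly.eq_of_irreducible_of_monic (minpoly.irreducible hsep.isIntegral) hr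
    (minpoly.monic hsep.isIntegral)
  have hx := minpoly.aeval K x
  rw [this, minpoly.eq_X_sub_C'] at hx
  refine ⟨c, ?_⟩
  simpa [sub_eq_zero, @eq_comm _ x] using hx

end SolvableExtensions

section RadicalPolynomials

theorem prod_range_add_natCast {k : Type*} [Field k] {p : ℕ} (hp : p.Prime) (h0 : (p : k) = 0)
    (y : k) : ∏ i ∈ Finset.range p, (y + i) = y ^ p - y := by
  have : Fact p.Prime := ⟨hp⟩
  have : CharP k p := (CharP.charP_iff_prime_eq_zero hp).2 h0
  have h1 : (X ^ p - X : (ZMod p)[X]) = ∏ a : ZMod p, (X - C a) := by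
    have hroots := FiniteField.roots_X_pow_card_sub_X (ZMod p)
    have hsp := FiniteField.splits_X_pow_card_sub_X (K := ZMod p) p
    rw [ZMod.card] at hroots hsp
    have h2 := hsp.eq_prod_roots_of_monic
      ((monic_X_pow_sub (n := p) (by rw [degree_X]; exact_mod_cast hp.one_lt)).map _)
    simp only [Polynomial.map_sub, Polynomial.map_pow, Polynomial.map_X] at h2
    rw [hroots] at h2
    exact h2
  have h2 := congrArg (eval₂ (ZMod.castHom dvd_rfl k) y) h1
  rw [eval₂_finsetProd] at h2
  simp only [eval₂_sub, eval₂_pow, eval₂_X, eval₂_C] at h2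
  rw [h2]
  refine Finset.prod_bij (fun i _ => -(i : ZMod p)) (fun _ _ => Finset.mem_univ _) ?_ ?_ ?_
  · intro a ha b hb hab
    rw [neg_inj, ZMod.natCast_eq_natCast_iff'] at hab
    rwa [Nat.mod_eq_of_lt (Finset.mem_range.1 ha), Nat.mod_eq_of_lt (Finset.mem_range.1 hb)] at hab
  · intro b _
    refine ⟨(-b).val, Finset.mem_range.2 (ZMod.val_lt _), ?_⟩
    rw [ZMod.natCast_zmod_val, neg_neg]
  · intro a _
    simp

theorem exists_natCast_of_pow_eq {k : Type*} [Field k] {p : ℕ} (hp : p.Prime) (h0 : (p : k) = 0)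
    {d : k} (hd : d ^ p = d) : ∃ i : ℕ, d + i = 0 := by
  have h := prod_range_add_natCast hp h0 d
  rw [hd, sub_self, Finset.prod_eq_zero_iff] at h
  obtain ⟨i, -, hi⟩ := h
  exact ⟨i, hi⟩

theorem sub_pow_of_natCast_eq_zero {k : Type*} [CommRing k] {p : ℕ} (hp : p.Prime)
    (h0 : (p : k) = 0) (x y : k) : (x - y) ^ p = x ^ p - y ^ p := by
  rcases subsingleton_or_nontrivial k with _ | _
  · exact Subsingleton.elim _ _
  have : Fact p.Prime := ⟨hp⟩
  have : CharP k p := (CharP.charP_iff_prime_eq_zero hp).2 h0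
  exact sub_pow_char x y

theorem gal_X_pow_sub_X_sub_C_isSolvable {F : Type*} [Field F] {p : ℕ} (hp : p.Prime)
    (h0 : (p : F) = 0) (a : F) : Group.IsSolvable (X ^ p - X - C a).Gal := by
  set q : F[X] := X ^ p - X - C a with hq
  have h0' : (p : q.SplittingField) = 0 := by
    rw [← map_natCast (algebraMap F q.SplittingField), h0, map_zero]
  have key (σ : q.Gal) (b : q.SplittingField) (hb : b ^ p - b = algebraMap F _ a) :
      ∃ i : ℕ, σ b = b - i := by
    have h2 : (σ b) ^ p - σ b = algebraMap F _ a := by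
      rw [← map_pow, ← map_sub, hb]
      exact σ.commutes a
    obtain ⟨i, hi⟩ := exists_natCast_of_pow_eq hp h0' (d := σ b - b) (by
      rw [sub_pow_of_natCast_eq_zero hp h0']
      linear_combination h2 - hb)
    exact ⟨i, by linear_combination hi⟩
  refine Group.isSolvable_of_comm fun σ τ => ?_
  ext b hb
  have hb' : b ^ p - b = algebraMap F _ a := by
    have := (mem_rootSet.1 hb).2
    simpa [hq, sub_eq_zero] using this
  obtain ⟨i, hi⟩ := key σ b hb'
  obtain ⟨j, hj⟩ := key τ b hb'
  change σ (τ b) = τ (σ b)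
  rw [hi, hj, map_sub, map_sub, hi, hj, map_natCast, map_natCast]
  ring

universe u v

variable {K : Type u} {E : Type v} [Field K] [Field E] [Algebra K E]

theorem isSolvable_gal_minpoly_of_comp {h : K[X]} {x y : E} (hd : h.natDegree ≠ 0)
    (hh : ∀ (N : Type u) [Field N] [Algebra K N] (c : N),
      Group.IsSolvable (h.map (algebraMap K N) - C c).Gal)
    (hxy : aeval x h = y) (hy : IsIntegral K y) (hsol : Group.IsSolvable (minpoly K y).Gal) :
    Group.IsSolvable (minpoly K x).Gal := by
  set p := minpoly K y
  have hp : p.comp h ≠ 0 := by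
    intro h0
    rcases comp_eq_zero_iff.mp h0 with h' | h'
    · exact minpoly.ne_zero hy h'
    · exact hd (by rw [h'.2, natDegree_C])
  apply gal_isSolvable_of_splits
  · exact ⟨(SplittingField.splits (p.comp h)).of_dvd (map_ne_zero hp)
      ((map_dvd_map' _).mpr (minpoly.dvd K x (by rw [aeval_comp, hxy, minpoly.aeval])))⟩
  · refine gal_isSolvable_tower p (p.comp h) ?_ hsol ?_
    · exact Gal.splits_in_splittingField_of_comp _ _ hd
    · obtain ⟨s, hs⟩ := splits_iff_exists_multiset.1 (SplittingField.splits p)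
      rw [map_comp, hs, mul_comp, C_comp]
      apply gal_mul_isSolvable (gal_C_isSolvable _)
      rw [multiset_prod_comp]
      apply gal_prod_isSolvable
      intro q hq
      rw [Multiset.mem_map] at hq
      obtain ⟨q, hq, rfl⟩ := hq
      rw [Multiset.mem_map] at hq
      obtain ⟨q, _, rfl⟩ := hq
      rw [sub_comp, X_comp, C_comp]
      exact hh _ q

theorem isSeparable_of_aeval_separable {h : K[X]} {x y : E}
    (hxy : aeval x h = y) (hy : IsSeparable K y)
    (hsep : (h.map (algebraMap K (IntermediateField.adjoin K {y})) -
      C (IntermediateField.AdjoinSimple.gen K y)).Separable) : IsSeparable K x := by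
  have := (IntermediateField.isSeparable_adjoin_simple_iff_isSeparable K E).2 hy
  refine IsSeparable.of_algebra_isSeparable_of_isSeparable K
    (E := IntermediateField.adjoin K {y}) (hsep.of_dvd (minpoly.dvd _ _ ?_))
  simp [hxy]

theorem isSeparable_and_isSolvable_of_pow {p : ℕ} (h0 : (p : K) ≠ 0) {x : E}
    (hsep : IsSeparable K (x ^ p)) (hsol : Group.IsSolvable (minpoly K (x ^ p)).Gal) :
    IsSeparable K x ∧ Group.IsSolvable (minpoly K x).Gal := by
  have hp : p ≠ 0 := by rintro rfl; simp at h0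
  refine ⟨?_, isSolvable_gal_minpoly_of_comp (h := X ^ p) (by simpa) (fun N _ _ c => ?_)
    (by simp) hsep.isIntegral hsol⟩
  · rcases eq_or_ne x 0 with rfl | hx
    · simpa [hp] using hsep
    refine isSeparable_of_aeval_separable (h := X ^ p) (by simp) hsep ?_
    rw [Polynomial.map_pow, map_X]
    refine separable_X_pow_sub_C _ ?_ ?_
    · rw [← map_natCast (algebraMap K _)]
      exact (_root_.map_ne_zero _).2 h0
    · intro h
      have := congrArg (algebraMap _ E) h
      rw [IntermediateField.AdjoinSimple.algebraMap_gen, map_zero] at this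
      exact pow_ne_zero p hx this
  · rw [Polynomial.map_pow, map_X]
    exact gal_X_pow_sub_C_isSolvable p c

theorem isSeparable_and_isSolvable_of_pow_sub_self {p : ℕ} (hp : p.Prime) (h0 : (p : K) = 0) {x : E}
    (hsep : IsSeparable K (x ^ p - x)) (hsol : Group.IsSolvable (minpoly K (x ^ p - x)).Gal) :
    IsSeparable K x ∧ Group.IsSolvable (minpoly K x).Gal := by
  refine ⟨?_, isSolvable_gal_minpoly_of_comp (h := X ^ p - X) ?_ (fun N _ _ c => ?_)
    (by simp) hsep.isIntegral hsol⟩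
  · refine isSeparable_of_aeval_separable (h := X ^ p - X) (by simp) hsep ?_
    rw [Polynomial.map_sub, Polynomial.map_pow, map_X, separable_def]
    simp only [derivative_sub, derivative_X_pow, derivative_X, derivative_C]
    have : (p : (IntermediateField.adjoin K {x ^ p - x})) = 0 := by
      rw [← map_natCast (algebraMap K _), h0, map_zero]
    rw [this]
    simpa using (isCoprime_one_right).neg_right
  · rw [FiniteField.X_pow_card_sub_X_natDegree_eq K hp.one_lt]
    exact hp.ne_zero
  · rw [Polynomial.map_sub, Polynomial.map_pow, map_X]
    exact gal_X_pow_sub_X_sub_C_isSolvable hp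
      (by rw [← map_natCast (algebraMap K N), h0, map_zero]) c

/-- Every element has a `p`-th root for primes `p` different from the characteristic, and is
of the form `b ^ p - b` if `p` is the characteristic. -/
def IsRadicalClosed (F : Type*) [Field F] : Prop :=
  ∀ p : ℕ, p.Prime → ((p : F) ≠ 0 → ∀ a : F, ∃ b, b ^ p = a) ∧
    ((p : F) = 0 → ∀ a : F, ∃ b, b ^ p - b = a)

theorem isSeparable_and_isSolvable_algebraMap (a : K) :
    IsSeparable K (algebraMap K E a) ∧ Group.IsSolvable (minpoly K (algebraMap K E a)).Gal := by
  refine ⟨isSeparable_algebraMap a, ?_⟩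
  rw [minpoly.eq_X_sub_C]
  infer_instance

theorem exists_pow_sub_self_eq [IsAlgClosed E] {p : ℕ} (hp : p.Prime) (a : E) :
    ∃ b : E, b ^ p - b = a := by
  have hd : (X ^ p - X - C a : E[X]).natDegree = p := by
    rw [natDegree_sub_C, FiniteField.X_pow_card_sub_X_natDegree_eq E hp.one_lt]
  obtain ⟨b, hb⟩ := IsAlgClosed.exists_root (X ^ p - X - C a : E[X]) (by
    rw [degree_eq_natDegree (by rintro h; rw [h] at hd; exact hp.ne_zero hd.symm), hd]
    exact_mod_cast hp.ne_zero)
  exact ⟨b, by simpa [sub_eq_zero] using hb⟩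

theorem IsSolvClosed.isRadicalClosed (hK : IsSolvClosed K) : IsRadicalClosed K := by
  refine fun p hp => ⟨fun h0 a => ?_, fun h0 a => ?_⟩
  · obtain ⟨b, hb⟩ := IsAlgClosed.exists_pow_nat_eq (algebraMap K (AlgebraicClosure K) a) hp.pos
    obtain ⟨h1, h2⟩ := isSeparable_and_isSolvable_algebraMap (E := AlgebraicClosure K) a
    rw [← hb] at h1 h2
    obtain ⟨h3, h4⟩ := isSeparable_and_isSolvable_of_pow h0 h1 h2
    obtain ⟨c, rfl⟩ := hK.mem_range h3 h4
    exact ⟨c, (algebraMap K (AlgebraicClosure K)).injective (by simpa using hb)⟩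
  · obtain ⟨b, hb⟩ := exists_pow_sub_self_eq hp (algebraMap K (AlgebraicClosure K) a)
    obtain ⟨h1, h2⟩ := isSeparable_and_isSolvable_algebraMap (E := AlgebraicClosure K) a
    rw [← hb] at h1 h2
    obtain ⟨h3, h4⟩ := isSeparable_and_isSolvable_of_pow_sub_self hp h0 h1 h2
    obtain ⟨c, rfl⟩ := hK.mem_range h3 h4
    exact ⟨c, (algebraMap K (AlgebraicClosure K)).injective (by simpa using hb)⟩

theorem splits_X_pow_sub_C_maxSolvableExt [IsAlgClosed E] {p : ℕ} (h0 : (p : K) ≠ 0)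
    (a : maxSolvableExt K E) : (X ^ p - C a).Splits := by
  have hp : p ≠ 0 := by rintro rfl; simp at h0
  have hne : (X ^ p - C a) ≠ 0 := X_pow_sub_C_ne_zero (Nat.pos_of_ne_zero hp) a
  refine Splits.of_splits_map (algebraMap (maxSolvableExt K E) E) (IsAlgClosed.splits _) ?_
  intro x hx
  have hx' : x ^ p = a := by
    rw [mem_roots (Polynomial.map_ne_zero hne)] at hx
    simpa [sub_eq_zero] using hx
  obtain ⟨h1, h2⟩ := mem_maxSolvableExt_iff.1 a.2
  rw [← hx'] at h1 h2
  exact ⟨⟨x, mem_maxSolvableExt_iff.2 (isSeparable_and_isSolvable_of_pow h0 h1 h2)⟩, rfl⟩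

theorem splits_X_pow_sub_X_sub_C_maxSolvableExt [IsAlgClosed E] {p : ℕ} (hp : p.Prime)
    (h0 : (p : K) = 0) (a : maxSolvableExt K E) : (X ^ p - X - C a).Splits := by
  have hne : (X ^ p - X - C a) ≠ 0 := by
    intro h
    have := congrArg natDegree h
    rw [natDegree_sub_C, FiniteField.X_pow_card_sub_X_natDegree_eq _ hp.one_lt] at this
    exact hp.ne_zero this
  refine Splits.of_splits_map (algebraMap (maxSolvableExt K E) E) (IsAlgClosed.splits _) ?_
  intro x hx
  have hx' : x ^ p - x = a := by
    rw [mem_roots (Polynomial.map_ne_zero hne)] at hx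
    simpa [sub_eq_zero] using hx
  obtain ⟨h1, h2⟩ := mem_maxSolvableExt_iff.1 a.2
  rw [← hx'] at h1 h2
  exact ⟨⟨x, mem_maxSolvableExt_iff.2 (isSeparable_and_isSolvable_of_pow_sub_self hp h0 h1 h2)⟩, rfl⟩

end RadicalPolynomials

section RadicalClosed

universe u

variable {F : Type u} [Field F]

/-- A cyclic extension of prime degree equal to the characteristic is generated by a root of an
Artin–Schreier polynomial. -/
theorem exists_apply_eq_add_one {M : Type*} [Field M] [Algebra F M] {p : ℕ} (hp : p.Prime)
    (h0 : (p : F) = 0) {σ : Gal(M/F)} (hσ : σ ^ p = 1) (hσ1 : σ ≠ 1) : ∃ α : M, σ α = α + 1 := by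
  have : Fact p.Prime := ⟨hp⟩
  set D : Module.End F M := σ.toLinearMap - 1 with hD
  have hDx (x : M) : D x = σ x - x := rfl
  have hchar : CharP (Module.End F M) p := by
    refine (CharP.charP_iff_prime_eq_zero hp).2 ?_
    rw [← map_natCast (algebraMap F (Module.End F M)), h0, map_zero]
  have hDp : D ^ p = 0 := by
    rw [hD, sub_pow_char_of_commute p (Commute.one_right _), one_pow, sub_eq_zero]
    ext x
    have hpow (n : ℕ) (x : M) : ((σ.toLinearMap : Module.End F M) ^ n) x = (σ ^ n) x := by
      induction n generalizing x with
      | zero => rfl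
      | succ n ih => rw [pow_succ, pow_succ]; exact ih _
    rw [hpow, hσ]
    rfl
  have hD0 : D ≠ 0 := fun h => hσ1 <| AlgEquiv.ext fun x => by
    have := LinearMap.congr_fun h x
    rw [hDx] at this
    exact sub_eq_zero.1 this
  classical
  have hex : ∃ n, D ^ n = 0 := ⟨p, hDp⟩
  let k := Nat.find hex
  have hk : D ^ k = 0 := Nat.find_spec hex
  have hk2 : 2 ≤ k := by
    by_contra! h
    interval_cases hk' : k
    · exact hD0 (by rw [← one_mul D, ← pow_zero D, hk, zero_mul])
    · exact hD0 (by rw [← pow_one D, hk])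
  obtain ⟨l, hl⟩ := Nat.exists_eq_add_of_le' hk2
  have hne : D ^ (l + 1) ≠ 0 := Nat.find_min hex (show l + 1 < k by omega)
  obtain ⟨x, hx⟩ : ∃ x, (D ^ (l + 1)) x ≠ 0 := by
    by_contra! h
    exact hne (LinearMap.ext h)
  set c := (D ^ (l + 1)) x with hc
  have h1 : D ((D ^ l) x) = c := by rw [hc, pow_succ']; rfl
  have h2 : D c = 0 := by
    rw [hl] at hk
    rw [hc, ← Module.End.mul_apply, ← pow_succ', hk]
    rfl
  rw [hDx, sub_eq_iff_eq_add'] at h1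
  rw [hDx, sub_eq_zero] at h2
  refine ⟨(D ^ l) x / c, ?_⟩
  rw [map_div₀, h1, h2, add_div, div_self hx]

theorem IsGalois.mem_range_of_isCyclic {M : Type*} [Field M] [Algebra F M] [FiniteDimensional F M]
    [IsGalois F M] {σ : Gal(M/F)} (hσ : ∀ τ, τ ∈ Subgroup.zpowers σ) {x : M} (hx : σ x = x) :
    x ∈ Set.range (algebraMap F M) := by
  rw [IsGalois.mem_range_algebraMap_iff_fixed]
  intro τ
  have : σ ∈ MulAction.stabilizer _ x := hx
  exact (Subgroup.zpowers_le.2 this) (hσ τ)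

theorem IsRadicalClosed.natCast_ne_zero_of_isCyclic (hF : IsRadicalClosed F) {M : Type*} [Field M]
    [Algebra F M] [FiniteDimensional F M] [IsGalois F M] {p : ℕ} (hp : p.Prime)
    (hcard : Nat.card Gal(M/F) = p) : (p : F) ≠ 0 := by
  intro h0
  have : Fact p.Prime := ⟨hp⟩
  have : IsCyclic Gal(M/F) := isCyclic_of_prime_card hcard
  obtain ⟨σ, hσ⟩ := IsCyclic.exists_generator (α := Gal(M/F))
  have hσ1 : σ ≠ 1 := by
    rintro rfl
    have : orderOf (1 : Gal(M/F)) = p := by rw [orderOf_eq_card_of_forall_mem_zpowers hσ, hcard]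
    rw [orderOf_one] at this
    exact hp.one_lt.ne this
  have hσp : σ ^ p = 1 := by rw [← hcard, pow_card_eq_one']
  obtain ⟨α, hα⟩ := exists_apply_eq_add_one hp h0 hσp hσ1
  have h0' : (p : M) = 0 := by rw [← map_natCast (algebraMap F M), h0, map_zero]
  have : CharP M p := (CharP.charP_iff_prime_eq_zero hp).2 h0'
  obtain ⟨a, ha⟩ := IsGalois.mem_range_of_isCyclic hσ (x := α ^ p - α) (by
    rw [map_sub, map_pow, hα, add_pow_char, one_pow]; ring)
  obtain ⟨b, hb⟩ := (hF p hp).2 h0 a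
  obtain ⟨i, hi⟩ := exists_natCast_of_pow_eq hp h0' (d := α - algebraMap F M b) (by
    rw [sub_pow_char, ← map_pow, ← sub_eq_zero]
    have := congrArg (algebraMap F M) hb
    rw [ha, map_sub] at this
    linear_combination -this)
  have hα' : α = algebraMap F M (b - i) := by
    rw [map_sub, map_natCast]
    linear_combination hi
  rw [hα', σ.commutes] at hα
  simp at hα

theorem IsRadicalClosed.natCast_eq_zero_of_isCyclic (hF : IsRadicalClosed F) {M : Type*} [Field M]
    [Algebra F M] [FiniteDimensional F M] [IsGalois F M] {p : ℕ} (hp : p.Prime)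
    (hcard : Nat.card Gal(M/F) = p) {ζ : F} (hζ : IsPrimitiveRoot ζ p) : (p : F) = 0 := by
  by_contra h0
  have : Fact p.Prime := ⟨hp⟩
  have : IsCyclic Gal(M/F) := isCyclic_of_prime_card hcard
  have hfin : Module.finrank F M = p := by rw [← hcard, IsGalois.card_aut_eq_finrank]
  obtain ⟨α, ⟨a, ha⟩, hα⟩ := exists_root_adjoin_eq_top_of_isCyclic F M
    ⟨ζ, by rw [hfin]; exact (mem_primitiveRoots hp.pos).2 hζ⟩
  rw [hfin] at ha
  obtain ⟨b, hb⟩ := (hF p hp).1 h0 a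
  have hmem : α ∈ (⊥ : IntermediateField F M) := by
    rw [IntermediateField.mem_bot]
    rcases eq_or_ne α 0 with rfl | hα0
    · exact ⟨0, map_zero _⟩
    have hb0 : algebraMap F M b ≠ 0 := by
      intro h
      rw [← hb, map_pow, h, zero_pow hp.ne_zero] at ha
      exact hα0 (pow_eq_zero_iff hp.ne_zero |>.1 ha.symm)
    obtain ⟨i, -, hi⟩ := (hζ.map_of_injective (algebraMap F M).injective).eq_pow_of_pow_eq_one
      (ξ := α / algebraMap F M b) (by
        rw [div_pow, ← ha, ← hb, map_pow, div_self (pow_ne_zero _ hb0)])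
    refine ⟨ζ ^ i * b, ?_⟩
    rw [map_mul, map_pow, hi, div_mul_cancel₀ _ hb0]
  have : (⊥ : IntermediateField F M) = ⊤ := by
    rw [← hα, eq_comm, IntermediateField.adjoin_simple_eq_bot_iff]
    exact hmem
  rw [IntermediateField.bot_eq_top_iff_finrank_eq_one, hfin] at this
  exact hp.one_lt.ne' this

theorem exists_isPrimitiveRoot_of_forall_finrank_eq_one {p : ℕ} (hp : p.Prime)
    (h0 : (p : F) ≠ 0)
    (h : ∀ (M : Type u) [Field M] [Algebra F M] [FiniteDimensional F M] [IsGalois F M],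
      Group.IsSolvable Gal(M/F) → Module.finrank F M < p → Module.finrank F M = 1) :
    ∃ ζ : F, IsPrimitiveRoot ζ p := by
  have : NeZero p := ⟨hp.ne_zero⟩
  have : NeZero (p : F) := ⟨h0⟩
  let E := CyclotomicField p F
  have : NeZero (p : E) := ⟨fun h => h0 (by
    rwa [← map_natCast (algebraMap F E), map_eq_zero] at h)⟩
  have hζ := IsCyclotomicExtension.zeta_spec p F E
  have : FiniteDimensional F E := IsCyclotomicExtension.finiteDimensional {p} F E
  have : IsGalois F E := IsCyclotomicExtension.isGalois {p} F E
  have hsol : Group.IsSolvable Gal(E/F) :=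
    Group.isSolvable_of_isSolvable_injective (f := hζ.autToPow F) (hζ.autToPow_injective F)
  have hlt : Module.finrank F E < p := by
    rw [(hζ.powerBasis F).finrank, ← (hζ.powerBasis F).natDegree_minpoly, hζ.powerBasis_gen F]
    refine (natDegree_le_of_dvd (minpoly.dvd F _ (p := cyclotomic p F) ?_)
      (cyclotomic_ne_zero p F)).trans_lt ?_
    · rw [aeval_def, eval₂_eq_eval_map, map_cyclotomic]
      exact hζ.isRoot_cyclotomic hp.pos
    · rw [natDegree_cyclotomic, Nat.totient_prime hp]
      exact Nat.sub_lt hp.pos one_pos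
  have h1 := h E hsol hlt
  rw [← IntermediateField.bot_eq_top_iff_finrank_eq_one] at h1
  obtain ⟨ζ, hz⟩ := IntermediateField.mem_bot.1 (h1 ▸ IntermediateField.mem_top :
    IsCyclotomicExtension.zeta p F E ∈ (⊥ : IntermediateField F E))
  rw [← hz] at hζ
  exact ⟨ζ, hζ.of_map_of_injective (algebraMap F E).injective⟩

theorem exists_prime_card_of_forall_finrank_eq_one {M : Type u} [Field M] [Algebra F M]
    [FiniteDimensional F M] [IsGalois F M] (hsol : Group.IsSolvable Gal(M/F))
    (hM : Module.finrank F M ≠ 1)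
    (h : ∀ (N : Type u) [Field N] [Algebra F N] [FiniteDimensional F N] [IsGalois F N],
      Group.IsSolvable Gal(N/F) → Module.finrank F N < Module.finrank F M →
      Module.finrank F N = 1) :
    (Nat.card Gal(M/F)).Prime := by
  have hcard := IsGalois.card_aut_eq_finrank F M
  have hnt : Nontrivial Gal(M/F) := by
    rw [← Finite.one_lt_card_iff_nontrivial, hcard]
    have := Module.finrank_pos (R := F) (M := M)
    omega
  have hsimple : IsSimpleGroup Gal(M/F) := by
    refine ⟨fun H hH => ?_⟩
    by_contra! hne
    have hgal : IsGalois F (IntermediateField.fixedField H) := inferInstance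
    have hs : Group.IsSolvable Gal(IntermediateField.fixedField H/F) :=
      Group.isSolvable_of_surjective (AlgEquiv.restrictNormalHom_surjective M
        (F := F) (K₁ := IntermediateField.fixedField H))
    have hmul := Module.finrank_mul_finrank F (IntermediateField.fixedField H) M
    rw [IntermediateField.finrank_fixedField_eq_card] at hmul
    have hpos := Module.finrank_pos (R := F) (M := IntermediateField.fixedField H)
    have hH1 : 1 < Nat.card H := (Subgroup.one_lt_card_iff_ne_bot H).2 hne.1
    have h1 := h (IntermediateField.fixedField H) hs (by nlinarith)
    rw [h1, one_mul, ← hcard] at hmul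
    exact hne.2 (Subgroup.eq_top_of_card_eq H hmul)
  have hcomm := IsSimpleGroup.comm_iff_isSolvable.2 hsol
  have : IsMulCommutative Gal(M/F) := ⟨⟨hcomm⟩⟩
  exact Group.is_simple_iff_prime_card.1 hsimple

theorem IsRadicalClosed.finrank_eq_one (hF : IsRadicalClosed F) (n : ℕ) :
    ∀ (M : Type u) [Field M] [Algebra F M] [FiniteDimensional F M] [IsGalois F M],
      Group.IsSolvable Gal(M/F) → Module.finrank F M = n → Module.finrank F M = 1 := by
  induction n using Nat.strong_induction_on with
  | _ n ih =>
    intro M _ _ _ _ hsol hn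
    by_contra hM
    have hp := exists_prime_card_of_forall_finrank_eq_one hsol hM
      fun N _ _ _ _ hN hlt => ih _ (hn ▸ hlt) N hN rfl
    have h0 := hF.natCast_ne_zero_of_isCyclic hp rfl
    obtain ⟨ζ, hζ⟩ := exists_isPrimitiveRoot_of_forall_finrank_eq_one hp h0
      fun N _ _ _ _ hN hlt => ih _ (by
        rwa [IsGalois.card_aut_eq_finrank, hn] at hlt) N hN rfl
    exact h0 (hF.natCast_eq_zero_of_isCyclic hp rfl hζ)

theorem IsRadicalClosed.isSolvClosed (hF : IsRadicalClosed F) : IsSolvClosed F :=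
  fun L _ _ h3 => IntermediateField.finrank_eq_one_iff.1 (hF.finrank_eq_one _ L h3 rfl)

end RadicalClosed

section Valuations

variable {L S : Type*} [Field L] [Field S]

theorem ValuationSubring.valuation_lt_one_iff_inv (W : ValuationSubring S) (x : S) :
    W.valuation x < 1 ↔ x = 0 ∨ x⁻¹ ∉ W := by
  rcases eq_or_ne x 0 with rfl | hx
  · simp
  · rw [← W.valuation_le_one_iff, map_inv₀, not_le, one_lt_inv₀ ((Valuation.pos_iff _).2 hx)]
    simp [hx]

theorem ValuationSubring.valuation_comap_lt_one_iff (W : ValuationSubring S) (f : L →+* S) (x : L) :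
    (W.comap f).valuation x < 1 ↔ W.valuation (f x) < 1 := by
  rw [valuation_lt_one_iff_inv, valuation_lt_one_iff_inv, mem_comap, map_inv₀, _root_.map_eq_zero]

theorem ValuationSubring.residue_eq_iff (W : ValuationSubring S) (x y : W) :
    IsLocalRing.residue W x = IsLocalRing.residue W y ↔ W.valuation (x - y : S) < 1 := by
  rw [← sub_eq_zero, ← map_sub, IsLocalRing.residue_eq_zero_iff, W.valuation_lt_one_iff]
  rfl

theorem ValuationSubring.residue_eq_zero_iff (W : ValuationSubring S) (x : W) :
    IsLocalRing.residue W x = 0 ↔ W.valuation (x : S) < 1 := by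
  rw [IsLocalRing.residue_eq_zero_iff, W.valuation_lt_one_iff]

theorem ValuationSubring.natCast_residueField_eq_zero_iff (W : ValuationSubring S) (n : ℕ) :
    (n : IsLocalRing.ResidueField W) = 0 ↔ W.valuation (n : S) < 1 := by
  rw [← map_natCast (IsLocalRing.residue W), W.residue_eq_zero_iff]
  rfl

theorem ValuationSubring.isRadicalClosed_residueField_iff (W : ValuationSubring S) :
    IsRadicalClosed (IsLocalRing.ResidueField W) ↔ ∀ p : ℕ, p.Prime →
      (¬ W.valuation (p : S) < 1 → ∀ b ∈ W, ∃ c ∈ W, W.valuation (c ^ p - b) < 1) ∧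
      (W.valuation (p : S) < 1 → ∀ b ∈ W, ∃ c ∈ W, W.valuation (c ^ p - c - b) < 1) := by
  refine forall_congr' fun p => forall_congr' fun _ => ?_
  rw [Ne, W.natCast_residueField_eq_zero_iff]
  refine and_congr (imp_congr_right fun _ => ?_) (imp_congr_right fun _ => ?_)
  · rw [IsLocalRing.residue_surjective.forall, Subtype.forall]
    refine forall_congr' fun b => forall_congr' fun hb => ?_
    rw [IsLocalRing.residue_surjective.exists, Subtype.exists]
    refine exists_congr fun c => (exists_congr fun hc => ?_).trans exists_prop
    rw [← map_pow, W.residue_eq_iff]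
    rfl
  · rw [IsLocalRing.residue_surjective.forall, Subtype.forall]
    refine forall_congr' fun b => forall_congr' fun hb => ?_
    rw [IsLocalRing.residue_surjective.exists, Subtype.exists]
    refine exists_congr fun c => (exists_congr fun hc => ?_).trans exists_prop
    rw [← map_pow, ← map_sub, W.residue_eq_iff]
    rfl

theorem exists_valuation_sub_lt_one_and_lt_one {Γ₁ Γ₂ : Type*}
    [LinearOrderedCommGroupWithZero Γ₁] [LinearOrderedCommGroupWithZero Γ₂]
    (v₁ : Valuation L Γ₁) (v₂ : Valuation L Γ₂) {z : L} (hz₁ : v₁ z < 1) (hz₂ : 1 < v₂ z)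
    {b : L} (hb : v₁ b ≤ 1) : ∃ a, v₁ (a - b) < 1 ∧ v₂ a < 1 := by
  have key {x : L} (h1 : v₁ x < 1) : v₁ (1 + x) = 1 ∧ 1 + x ≠ 0 := by
    have := v₁.map_one_add_of_lt h1
    exact ⟨this, fun h => by simp [h] at this⟩
  have key2 {x : L} (h1 : 1 < v₂ x) : v₂ (1 + x) = v₂ x :=
    v₂.map_add_eq_of_lt_right (by rwa [map_one])
  by_cases hb2 : v₂ b ≤ 1
  · obtain ⟨h1, h2⟩ := key hz₁
    refine ⟨b / (1 + z), ?_, ?_⟩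
    · rw [show b / (1 + z) - b = -(z * b) / (1 + z) by field_simp; ring, map_div₀, h1, div_one,
        Valuation.map_neg, map_mul]
      exact mul_lt_one_of_lt_of_le hz₁ hb
    · rw [map_div₀, key2 hz₂]
      exact (div_lt_one₀ (zero_lt_one.trans hz₂)).2 (hb2.trans_lt hz₂)
  · push Not at hb2
    have h3 : v₁ (z * b) < 1 := by rw [map_mul]; exact mul_lt_one_of_lt_of_le hz₁ hb
    have h4 : 1 < v₂ (z * b) := by rw [map_mul]; exact one_lt_mul'' hz₂ hb2
    obtain ⟨h1, h2⟩ := key h3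
    refine ⟨b / (1 + z * b), ?_, ?_⟩
    · rw [show b / (1 + z * b) - b = -((z * b) * b) / (1 + z * b) by
          rw [eq_div_iff h2, sub_mul, div_mul_cancel₀ _ h2]; ring, map_div₀, h1,
        div_one, Valuation.map_neg, map_mul]
      exact mul_lt_one_of_lt_of_le h3 hb
    · rw [map_div₀, key2 h4, map_mul]
      refine (div_lt_one₀ (mul_pos (zero_lt_one.trans hz₂) (zero_lt_one.trans hb2))).2 ?_
      exact lt_mul_of_one_lt_left (zero_lt_one.trans hb2) hz₂

/-- A weak form of continuity of roots. -/
theorem exists_root_valuation_sub_lt {Γ : Type*} [LinearOrderedCommGroupWithZero Γ]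
    (v : Valuation S Γ) {g : S[X]} (hg : g.Splits) (hm : g.Monic) {c : S} {γ : Γ}
    (hc : v (g.eval c) < γ ^ g.natDegree) : ∃ r, g.eval r = 0 ∧ v (c - r) < γ := by
  by_contra! h
  have key (m : Multiset S) (hr : ∀ r ∈ m, γ ≤ v (c - r)) :
      γ ^ m.card ≤ v ((m.map fun r => X - C r).prod.eval c) := by
    induction m using Multiset.induction_on with
    | empty => simp
    | cons a m ih =>
      rw [Multiset.map_cons, Multiset.prod_cons, eval_mul, map_mul, Multiset.card_cons, pow_succ']
      refine mul_le_mul' ?_ (ih fun r hr' => hr r (Multiset.mem_cons_of_mem hr'))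
      simpa using hr a (Multiset.mem_cons_self a m)
  have h1 := key g.roots fun r hr => h r (mem_roots'.1 hr).2
  rw [← hg.eq_prod_roots_of_monic hm, ← hg.natDegree_eq_card_roots] at h1
  exact h1.not_gt hc

theorem eq_of_pow_eq_pow_of_map_eq_one {R k : Type*} [CommRing R] [IsDomain R] [CommRing k]
    (f : R →+* k) {p : ℕ} (hp : (p : k) ≠ 0) {x y : R} (hx : f x = 1) (hy : f y = 1)
    (h : x ^ p = y ^ p) : x = y := by
  have h1 := (Commute.all x y).geom_sum₂_mul p
  rw [h, sub_self, mul_eq_zero, sub_eq_zero] at h1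
  refine h1.resolve_left fun h2 => hp ?_
  have := congrArg f h2
  simpa [hx, hy] using this

theorem eq_zero_of_pow_eq_of_map_eq_zero {R k : Type*} [CommRing R] [IsDomain R] [CommRing k]
    [Nontrivial k] (f : R →+* k) {p : ℕ} (hp : 1 < p) {x : R} (hx : f x = 0) (h : x ^ p = x) :
    x = 0 := by
  obtain ⟨n, rfl⟩ := Nat.exists_eq_add_of_le' hp
  by_contra h0
  have h1 : x ^ (n + 1) = 1 := mul_right_cancel₀ h0 (by rw [← pow_succ, one_mul]; exact h)
  have := congrArg f h1
  rw [map_pow, hx, map_one, zero_pow n.succ_ne_zero] at this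
  exact zero_ne_one this

variable [Algebra L S]

theorem ValuationSubring.valuation_apply_lt_one {W : ValuationSubring S}
    (hW : ∀ σ : Gal(S/L), ∀ x ∈ W, σ x ∈ W) (σ : Gal(S/L)) {x : S} (hx : W.valuation x < 1) :
    W.valuation (σ x) < 1 := by
  rw [valuation_lt_one_iff_inv] at hx ⊢
  refine hx.imp (fun h => by rw [h, map_zero]) fun h h1 => h ?_
  have := hW σ⁻¹ _ h1
  rwa [← map_inv₀, ← AlgEquiv.mul_apply, inv_mul_cancel] at this

theorem mem_range_of_unique [IsGalois L S] {P : S → Prop} {x : S} (hx : P x)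
    (huniq : ∀ y, P y → y = x) (hP : ∀ (σ : Gal(S/L)) y, P y → P (σ y)) :
    ∃ c, algebraMap L S c = x :=
  (InfiniteGalois.mem_range_algebraMap_iff_fixed x).2 fun σ => huniq _ (hP σ x hx)

end Valuations

section InvariantValuations

variable {L S : Type*} [Field L] [Field S]

theorem ValuationSubring.exists_residue_eq_one (W : ValuationSubring S) {x : S}
    (hx : W.valuation (x - 1) < 1) :
    ∃ h : x ∈ W, IsLocalRing.residue W ⟨x, h⟩ = 1 := by
  have h : x ∈ W := by
    have := W.add_mem _ _ ((W.valuation_le_one_iff _).1 hx.le) W.one_mem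
    rwa [sub_add_cancel] at this
  refine ⟨h, ?_⟩
  rw [← map_one (IsLocalRing.residue W), W.residue_eq_iff]
  exact hx

theorem ValuationSubring.exists_residue_eq_zero (W : ValuationSubring S) {x : S}
    (hx : W.valuation x < 1) :
    ∃ h : x ∈ W, IsLocalRing.residue W ⟨x, h⟩ = 0 :=
  ⟨(W.valuation_le_one_iff _).1 hx.le, (W.residue_eq_zero_iff _).2 hx⟩

theorem ValuationSubring.eq_of_pow_eq_pow (W : ValuationSubring S) {p : ℕ}
    (hp : ¬ W.valuation (p : S) < 1) {x y : S} (hx : W.valuation (x - 1) < 1)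
    (hy : W.valuation (y - 1) < 1) (h : x ^ p = y ^ p) : x = y := by
  rw [← W.natCast_residueField_eq_zero_iff] at hp
  obtain ⟨hx1, hx2⟩ := W.exists_residue_eq_one hx
  obtain ⟨hy1, hy2⟩ := W.exists_residue_eq_one hy
  exact congrArg Subtype.val
    (eq_of_pow_eq_pow_of_map_eq_one _ hp hx2 hy2 (Subtype.ext h))

theorem ValuationSubring.eq_zero_of_pow_eq (W : ValuationSubring S) {p : ℕ} (hp : 1 < p) {x : S}
    (hx : W.valuation x < 1) (h : x ^ p = x) : x = 0 := by
  obtain ⟨hx1, hx2⟩ := W.exists_residue_eq_zero hx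
  exact congrArg Subtype.val (eq_zero_of_pow_eq_of_map_eq_zero _ hp hx2 (Subtype.ext h))

theorem exists_isPrimitiveRoot_of_splits {p : ℕ} (hp : p.Prime) (h0 : (p : S) ≠ 0)
    (hsplit : (X ^ p - C (1 : S)).Splits) : ∃ ξ : S, IsPrimitiveRoot ξ p := by
  have : NeZero (p : S) := ⟨h0⟩
  have hs : (cyclotomic p S).Splits :=
    hsplit.of_dvd (X_pow_sub_C_ne_zero hp.pos _) (by simpa using cyclotomic.dvd_X_pow_sub_one p S)
  obtain ⟨ξ, hξ⟩ := hs.exists_eval_eq_zero (degree_cyclotomic_pos p S hp.pos).ne'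
  exact ⟨ξ, isRoot_cyclotomic_iff.1 hξ⟩

section Root

variable (W : ValuationSubring S) {p : ℕ} {ξ : S}

theorem ValuationSubring.exists_residue_eq_one_of_isPrimitiveRoot (hp : p.Prime)
    (hpW : W.valuation (p : S) < 1) (hξ : ξ ^ p = 1) :
    ∃ h : ξ ∈ W, IsLocalRing.residue W ⟨ξ, h⟩ = 1 := by
  have h : ξ ∈ W := by
    rw [← W.valuation_le_one_iff]
    have := congrArg W.valuation hξ
    rw [map_pow, map_one, pow_eq_one_iff_of_nonneg zero_le hp.ne_zero] at this
    exact this.le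
  refine ⟨h, ?_⟩
  rw [← W.natCast_residueField_eq_zero_iff] at hpW
  rw [← sub_eq_zero, ← pow_eq_zero_iff hp.ne_zero, sub_pow_of_natCast_eq_zero hp hpW, one_pow,
    ← map_pow, sub_eq_zero, ← map_one (IsLocalRing.residue W)]
  exact congrArg _ (Subtype.ext hξ)

theorem ValuationSubring.eq_of_one_add_pow_eq_one_add_pow (hp : p.Prime)
    (hpW : W.valuation (p : S) < 1) (hξ : IsPrimitiveRoot ξ p) {y y' : S}
    (hy : W.valuation y < 1) (hy' : W.valuation y' < 1)
    (h : (1 + (1 - ξ) * y) ^ p = (1 + (1 - ξ) * y') ^ p) : y = y' := by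
  have hξ1 : 1 - ξ ≠ 0 := sub_ne_zero.2 (hξ.ne_one hp.one_lt).symm
  obtain ⟨h1, h2⟩ := W.exists_residue_eq_one_of_isPrimitiveRoot hp hpW hξ.pow_eq_one
  obtain ⟨hy1, hy2⟩ := W.exists_residue_eq_zero hy
  obtain ⟨hy1', hy2'⟩ := W.exists_residue_eq_zero hy'
  have : NeZero p := ⟨hp.ne_zero⟩
  set R : W := 1 + (1 - ⟨ξ, h1⟩) * ⟨y, hy1⟩ with hR
  have hRres : IsLocalRing.residue W R = 1 := by simp [hR, hy2]
  have hR0 : 1 + (1 - ξ) * y ≠ 0 := by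
    intro h0
    have : R = 0 := Subtype.ext h0
    rw [this, map_zero] at hRres
    exact zero_ne_one hRres
  obtain ⟨k, hk, hk'⟩ := hξ.eq_pow_of_pow_eq_one (ξ := (1 + (1 - ξ) * y') / (1 + (1 - ξ) * y)) (by
    rw [div_pow, h, div_self]
    rw [← h]
    exact pow_ne_zero _ hR0)
  rw [eq_div_iff hR0] at hk'
  have h3 : y - y' = (1 + (1 - ξ) * y) * ∑ i ∈ Finset.range k, ξ ^ i := by
    apply mul_left_cancel₀ hξ1
    rw [mul_left_comm, mul_neg_geom_sum]
    linear_combination hk'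
  have h4 : (⟨y, hy1⟩ - ⟨y', hy1'⟩ : W) = R * ∑ i ∈ Finset.range k, ⟨ξ, h1⟩ ^ i :=
    Subtype.ext (by simpa [hR] using h3)
  have h5 := congrArg (IsLocalRing.residue W) h4
  simp only [map_sub, map_mul, map_sum, map_pow, hy2, hy2', h2, hRres, sub_zero, one_pow, one_mul,
    Finset.sum_const, Finset.card_range, nsmul_eq_mul, mul_one] at h5
  rw [← W.natCast_residueField_eq_zero_iff] at hpW
  have : CharP (IsLocalRing.ResidueField W) p := (CharP.charP_iff_prime_eq_zero hp).2 hpW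
  have hk0 : k = 0 := Nat.eq_zero_of_dvd_of_lt ((CharP.cast_eq_zero_iff _ p k).1 h5.symm) hk
  rw [hk0, Finset.range_zero, Finset.sum_empty, mul_zero, sub_eq_zero] at h3
  exact h3

theorem ValuationSubring.exists_one_add_pow_eq (hp : p.Prime) (hξ : ξ ≠ 1) {a : S}
    (ha : W.valuation a < 1) (hsplit : ∀ a : S, (X ^ p - C a).Splits) :
    ∃ y, W.valuation y < 1 ∧ (1 + (1 - ξ) * y) ^ p = 1 + (1 - ξ) ^ p * a := by
  have hξ1 : 1 - ξ ≠ 0 := sub_ne_zero.2 hξ.symm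
  have hpos : 0 < W.valuation (1 - ξ) := (Valuation.pos_iff _).2 hξ1
  obtain ⟨r, hr1, hr2⟩ := exists_root_valuation_sub_lt W.valuation (c := 1)
    (γ := W.valuation (1 - ξ)) (hsplit (1 + (1 - ξ) ^ p * a)) (monic_X_pow_sub_C _ hp.ne_zero) (by
      rw [natDegree_X_pow_sub_C]
      simp only [eval_sub, eval_pow, eval_X, eval_C, one_pow, sub_add_cancel_left,
        Valuation.map_neg, map_mul, map_pow]
      exact mul_lt_of_lt_one_right (pow_pos hpos _) ha)
  simp only [eval_sub, eval_pow, eval_X, eval_C, sub_eq_zero] at hr1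
  refine ⟨(r - 1) / (1 - ξ), ?_, ?_⟩
  · rw [map_div₀, div_lt_one₀ hpos, Valuation.map_sub_swap]
    exact hr2
  · rw [mul_div_cancel₀ _ hξ1, add_sub_cancel, hr1]

theorem ValuationSubring.residue_pow_sub_self_of_one_add_pow_eq (hp : p.Prime)
    (hpW : W.valuation (p : S) < 1) (hξ : IsPrimitiveRoot ξ p) {y a : S} (ha : a ∈ W)
    (h : (1 + (1 - ξ) * y) ^ p = 1 + (1 - ξ) ^ p * a) :
    ∃ hy : y ∈ W, (IsLocalRing.residue W ⟨y, hy⟩) ^ p - IsLocalRing.residue W ⟨y, hy⟩ =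
      IsLocalRing.residue W ⟨a, ha⟩ := by
  have hξ1 : 1 - ξ ≠ 0 := sub_ne_zero.2 (hξ.ne_one hp.one_lt).symm
  obtain ⟨h1, h2⟩ := W.exists_residue_eq_one_of_isPrimitiveRoot hp hpW hξ.pow_eq_one
  set s : ℕ → W := fun i => ∑ j ∈ Finset.range i, ⟨ξ, h1⟩ ^ j with hs
  have hs' (i : ℕ) : (1 - ξ) * (s i : S) = 1 - ξ ^ i := by
    rw [← mul_neg_geom_sum]
    simp [hs]
  have hprod : ∏ i ∈ Finset.range p, (y + s i) = a := by
    apply mul_left_cancel₀ (pow_ne_zero p hξ1)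
    have h3 := congrArg (eval (1 + (1 - ξ) * y))
      (X_pow_sub_C_eq_prod hξ hp.pos (one_pow p : (1 : S) ^ p = 1))
    simp only [eval_sub, eval_pow, eval_X, eval_C, eval_prod, mul_one] at h3
    rw [h, add_sub_cancel_left] at h3
    rw [h3, ← Finset.card_range p, ← Finset.prod_const, Finset.card_range,
      ← Finset.prod_mul_distrib]
    refine Finset.prod_congr rfl fun i _ => ?_
    rw [mul_add, hs']
    ring
  have hy : y ∈ W := by
    rw [← W.valuation_le_one_iff]
    by_contra! hy
    have h3 (i : ℕ) : W.valuation (y + s i) = W.valuation y :=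
      Valuation.map_add_eq_of_lt_left _ (((W.valuation_le_one_iff _).2 (s i).2).trans_lt hy)
    have h4 := congrArg W.valuation hprod
    simp only [map_prod, h3, Finset.prod_const, Finset.card_range] at h4
    have h5 := (W.valuation_le_one_iff _).2 ha
    rw [← h4] at h5
    exact h5.not_gt (one_lt_pow₀ hy hp.ne_zero)
  refine ⟨hy, ?_⟩
  rw [← W.natCast_residueField_eq_zero_iff] at hpW
  rw [← prod_range_add_natCast hp hpW]
  have h3 : ∏ i ∈ Finset.range p, (⟨y, hy⟩ + s i) = (⟨a, ha⟩ : W) :=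
    Subtype.ext (by simpa using hprod)
  rw [← h3, map_prod]
  refine Finset.prod_congr rfl fun i _ => ?_
  simp only [hs, map_add, map_sum, map_pow, h2, one_pow, Finset.sum_const, Finset.card_range,
    nsmul_eq_mul, mul_one]

end Root

variable [Algebra L S] [IsGalois L S] (W : ValuationSubring S)

theorem exists_pow_eq_one_add (hW : ∀ σ : Gal(S/L), ∀ x ∈ W, σ x ∈ W) {p : ℕ} (hp : p ≠ 0)
    (hpW : ¬ W.valuation (p : S) < 1) (hsplit : ∀ a : S, (X ^ p - C a).Splits) {a : L}
    (ha : W.valuation (algebraMap L S a) < 1) : ∃ r : L, r ^ p = 1 + a := by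
  obtain ⟨r, hr1, hr2⟩ := exists_root_valuation_sub_lt W.valuation (c := 1)
    (γ := 1) (hsplit (1 + algebraMap L S a)) (monic_X_pow_sub_C _ hp) (by
      simpa using ha)
  simp only [eval_sub, eval_pow, eval_X, eval_C, sub_eq_zero] at hr1
  rw [Valuation.map_sub_swap] at hr2
  obtain ⟨c, rfl⟩ := mem_range_of_unique (L := L)
    (P := fun y => y ^ p = 1 + algebraMap L S a ∧ W.valuation (y - 1) < 1) ⟨hr1, hr2⟩
    (fun y hy => W.eq_of_pow_eq_pow hpW hy.2 hr2 (hy.1.trans hr1.symm)) (fun σ y hy => by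
      refine ⟨?_, ?_⟩
      · rw [← map_pow, hy.1, map_add, map_one, σ.commutes]
      · rw [← map_one σ, ← map_sub]
        exact W.valuation_apply_lt_one hW σ hy.2)
  exact ⟨c, (algebraMap L S).injective (by simpa using hr1)⟩

theorem exists_pow_sub_self_eq_of_lt_one (hW : ∀ σ : Gal(S/L), ∀ x ∈ W, σ x ∈ W) {p : ℕ}
    (hp : p.Prime) (h0 : (p : S) = 0) (hsplit : ∀ a : S, (X ^ p - X - C a).Splits) {a : L}
    (ha : W.valuation (algebraMap L S a) < 1) : ∃ r : L, r ^ p - r = a := by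
  obtain ⟨r, hr1, hr2⟩ := exists_root_valuation_sub_lt W.valuation (c := 0)
    (γ := 1) (hsplit (algebraMap L S a)) (by
      rw [sub_sub]
      exact monic_X_pow_sub ((degree_X_add_C _).trans_lt (by exact_mod_cast hp.one_lt))) (by
      simpa [hp.ne_zero] using ha)
  simp only [eval_sub, eval_pow, eval_X, eval_C, sub_eq_zero] at hr1
  rw [zero_sub, Valuation.map_neg] at hr2
  obtain ⟨c, rfl⟩ := mem_range_of_unique (L := L)
    (P := fun y => y ^ p - y = algebraMap L S a ∧ W.valuation y < 1) ⟨hr1, hr2⟩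
    (fun y hy => by
      rw [← sub_eq_zero]
      refine W.eq_zero_of_pow_eq hp.one_lt (Valuation.map_sub_lt _ hy.2 hr2) ?_
      rw [sub_pow_of_natCast_eq_zero hp h0]
      linear_combination hy.1 - hr1) (fun σ y hy => by
      refine ⟨?_, W.valuation_apply_lt_one hW σ hy.2⟩
      rw [← map_pow, ← map_sub, hy.1, σ.commutes])
  exact ⟨c, (algebraMap L S).injective (by simpa using hr1)⟩

end InvariantValuations

section IndependentValuations

variable {L S : Type*} [Field L] [Field S] [Algebra L S] [IsGalois L S]

theorem exists_pow_sub_self_add_lt_one (W₁ W₂ : ValuationSubring S)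
    (hW : ∀ σ : Gal(S/L), ∀ x ∈ W₂, σ x ∈ W₂) {p : ℕ} (hp : p.Prime) (h0 : (p : S) ≠ 0)
    (hp₁ : W₁.valuation (p : S) < 1) (hp₂ : W₂.valuation (p : S) < 1)
    (hsplit : ∀ a : S, (X ^ p - C a).Splits) {a : L}
    (ha₁ : algebraMap L S a ∈ W₁) (ha₂ : W₂.valuation (algebraMap L S a) < 1) :
    ∃ t : L, algebraMap L S t ∈ W₁ ∧ W₁.valuation (algebraMap L S (t ^ p - t + a)) < 1 := by
  obtain ⟨ξ₀, hξ₀⟩ := exists_isPrimitiveRoot_of_splits hp h0 (hsplit 1)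
  have hex (ξ : S) : ∃ y, IsPrimitiveRoot ξ p → W₂.valuation y < 1 ∧
      (1 + (1 - ξ) * y) ^ p = 1 + (1 - ξ) ^ p * algebraMap L S a := by
    by_cases hξ : IsPrimitiveRoot ξ p
    · obtain ⟨y, hy⟩ := W₂.exists_one_add_pow_eq hp (hξ.ne_one hp.one_lt) ha₂ hsplit
      exact ⟨y, fun _ => hy⟩
    · exact ⟨0, fun h => absurd h hξ⟩
  choose y hy using hex
  have hσy (σ : Gal(S/L)) {ξ : S} (hξ : IsPrimitiveRoot ξ p) : σ (y ξ) = y (σ ξ) := by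
    have hξ' : IsPrimitiveRoot (σ ξ) p := hξ.map_of_injective σ.injective
    refine W₂.eq_of_one_add_pow_eq_one_add_pow hp hp₂ hξ'
      (W₂.valuation_apply_lt_one hW σ (hy ξ hξ).1) (hy _ hξ').1 ?_
    rw [(hy _ hξ').2]
    have h := congrArg σ (hy ξ hξ).2
    simpa using h
  obtain ⟨t, ht⟩ := (InfiniteGalois.mem_range_algebraMap_iff_fixed (k := L)
    (∑ ξ ∈ primitiveRoots p S, y ξ)).2 fun σ => by
      rw [map_sum]
      refine Finset.sum_equiv σ.toEquiv (fun ξ => ?_) fun ξ hξ =>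
        hσy σ ((mem_primitiveRoots hp.pos).1 hξ)
      rw [mem_primitiveRoots hp.pos, mem_primitiveRoots hp.pos]
      exact ⟨fun h => h.map_of_injective (f := σ) σ.injective,
        fun h => h.of_map_of_injective (f := σ) σ.injective⟩
  have hres (ξ : S) (hξ : ξ ∈ primitiveRoots p S) :=
    W₁.residue_pow_sub_self_of_one_add_pow_eq hp hp₁ ((mem_primitiveRoots hp.pos).1 hξ) ha₁
      (hy ξ ((mem_primitiveRoots hp.pos).1 hξ)).2
  choose hmem hres using hres
  have htmem : algebraMap L S t ∈ W₁ := by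
    rw [ht]
    exact sum_mem hmem
  refine ⟨t, htmem, ?_⟩
  have hpk := hp₁
  rw [← W₁.natCast_residueField_eq_zero_iff] at hpk
  have : Fact p.Prime := ⟨hp⟩
  have : CharP (IsLocalRing.ResidueField W₁) p := (CharP.charP_iff_prime_eq_zero hp).2 hpk
  have ht' : (⟨algebraMap L S t, htmem⟩ : W₁) =
      ∑ ξ ∈ (primitiveRoots p S).attach, ⟨y ξ.1, hmem ξ.1 ξ.2⟩ := by
    refine Subtype.ext ?_
    simp only [AddSubmonoidClass.coe_finsetSum, ht]
    rw [Finset.sum_attach (primitiveRoots p S) y]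
  have h1 : IsLocalRing.residue W₁ ⟨algebraMap L S t, htmem⟩ ^ p -
      IsLocalRing.residue W₁ ⟨algebraMap L S t, htmem⟩ =
      - IsLocalRing.residue W₁ ⟨algebraMap L S a, ha₁⟩ := by
    rw [ht', map_sum, sum_pow_char, ← Finset.sum_sub_distrib,
      Finset.sum_congr rfl fun ξ _ => hres ξ.1 ξ.2, Finset.sum_const, Finset.card_attach,
      hξ₀.card_primitiveRoots, Nat.totient_prime hp, nsmul_eq_mul, Nat.cast_sub hp.one_le, hpk,
      Nat.cast_one, zero_sub, neg_one_mul]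
  rw [← map_pow, ← map_sub, eq_neg_iff_add_eq_zero, ← map_add, W₁.residue_eq_zero_iff] at h1
  simpa using h1

/-- If a Galois extension `S` of `L` is closed under radicals and carries two valuations such
that the second one is `Gal(S/L)`-invariant and both are sufficiently independent on `L`, then the
residue field of `L` for the first one is closed under radicals. -/
theorem isRadicalClosed_residueField_comap (W₁ W₂ : ValuationSubring S)
    (hW : ∀ σ : Gal(S/L), ∀ x ∈ W₂, σ x ∈ W₂) {z : L}
    (hz₁ : W₁.valuation (algebraMap L S z) < 1) (hz₂ : 1 < W₂.valuation (algebraMap L S z))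
    (hchar : ∀ p : ℕ, W₁.valuation (p : S) < 1 ↔ W₂.valuation (p : S) < 1)
    (hsplit : ∀ p : ℕ, p.Prime → (p : S) ≠ 0 → ∀ a : S, (X ^ p - C a).Splits)
    (hsplit' : ∀ p : ℕ, p.Prime → (p : S) = 0 → ∀ a : S, (X ^ p - X - C a).Splits) :
    IsRadicalClosed (IsLocalRing.ResidueField (W₁.comap (algebraMap L S))) := by
  have approx {b : L} (hb : algebraMap L S b ∈ W₁) :
      ∃ a, W₁.valuation (algebraMap L S (a - b)) < 1 ∧ W₂.valuation (algebraMap L S a) < 1 ∧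
        algebraMap L S a ∈ W₁ := by
    obtain ⟨a, h1, h2⟩ := exists_valuation_sub_lt_one_and_lt_one
      (W₁.valuation.comap (algebraMap L S)) (W₂.valuation.comap (algebraMap L S)) hz₁ hz₂
      (b := b) ((W₁.valuation_le_one_iff _).2 hb)
    refine ⟨a, h1, h2, ?_⟩
    have := W₁.add_mem _ _ ((W₁.valuation_le_one_iff _).1 (le_of_lt h1)) hb
    rwa [← map_add, sub_add_cancel] at this
  rw [ValuationSubring.isRadicalClosed_residueField_iff]
  intro p hp
  simp_rw [ValuationSubring.valuation_comap_lt_one_iff, ValuationSubring.mem_comap, map_natCast]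
  refine ⟨fun hpW b hb => ?_, fun hpW b hb => ?_⟩
  · have h0 : (p : S) ≠ 0 := fun h => hpW (by rw [h, map_zero]; exact zero_lt_one)
    obtain ⟨a, ha1, ha2, -⟩ := approx (b := b - 1) (by
      rw [map_sub, map_one]; exact sub_mem hb W₁.one_mem)
    obtain ⟨r, hr⟩ := exists_pow_eq_one_add W₂ hW hp.ne_zero ((hchar p).not.1 hpW)
      (hsplit p hp h0) ha2
    have h1 : r ^ p - b = a - (b - 1) := by rw [hr]; ring
    rw [← h1] at ha1
    refine ⟨r, ?_, ha1⟩
    have h2 := W₁.add_mem _ _ ((W₁.valuation_le_one_iff _).1 ha1.le) hb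
    rw [← map_add, sub_add_cancel, map_pow] at h2
    rw [← W₁.valuation_le_one_iff, map_pow] at h2
    exact (W₁.valuation_le_one_iff _).1 ((pow_le_one_iff_of_nonneg zero_le hp.ne_zero).1 h2)
  · obtain ⟨a, ha1, ha2, ha3⟩ := approx hb
    by_cases h0 : (p : S) = 0
    · obtain ⟨r, hr⟩ := exists_pow_sub_self_eq_of_lt_one W₂ hW hp h0 (hsplit' p hp h0) ha2
      refine ⟨r, ?_, by rwa [hr]⟩
      rw [← W₁.valuation_le_one_iff]
      by_contra! h
      have h2 := (W₁.valuation_le_one_iff _).2 ha3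
      rw [← hr, map_sub, map_pow, Valuation.map_sub_eq_of_lt_left, map_pow] at h2
      · exact h2.not_gt (one_lt_pow₀ h hp.ne_zero)
      · rw [map_pow]
        exact lt_self_pow₀ h hp.one_lt
    · obtain ⟨t, ht1, ht2⟩ := exists_pow_sub_self_add_lt_one W₁ W₂ hW hp h0 hpW
        ((hchar p).1 hpW) (hsplit p hp h0) ha3 ha2
      refine ⟨-t, by rw [map_neg]; exact neg_mem ht1, ?_⟩
      have h1 : W₁.valuation (algebraMap L S ((-t) ^ p + t ^ p)) < 1 := by
        rcases hp.eq_two_or_odd' with rfl | hodd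
        · rw [show (-t) ^ 2 + t ^ 2 = (2 : ℕ) * t ^ 2 by push_cast; ring, map_mul, map_natCast,
            map_mul]
          exact mul_lt_one_of_lt_of_le hpW ((W₁.valuation_le_one_iff _).2
            (by rw [map_pow]; exact pow_mem ht1 2))
        · rw [hodd.neg_pow, neg_add_cancel, map_zero, map_zero]
          exact zero_lt_one
      rw [show (-t) ^ p - -t - b = ((-t) ^ p + t ^ p) - (t ^ p - t + a) + (a - b) by ring,
        map_add, map_sub]
      exact Valuation.map_add_lt _ (Valuation.map_sub_lt _ h1 ht2) ha1

end IndependentValuations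

section BaseChange

theorem isSolvable_gal_map {K L : Type*} [Field K] [Field L] [Algebra K L] (p : K[X])
    (hp : Group.IsSolvable p.Gal) : Group.IsSolvable (p.map (algebraMap K L)).Gal := by
  set q := p.map (algebraMap K L) with hq
  have hs : (p.map (algebraMap K q.SplittingField)).Splits := by
    rw [IsScalarTower.algebraMap_eq K L, ← Polynomial.map_map]
    exact SplittingField.splits q
  have : Fact (p.map (algebraMap K q.SplittingField)).Splits := ⟨hs⟩
  let f : q.Gal →* p.Gal := (Gal.restrict p q.SplittingField).comp
    (AlgEquiv.restrictScalarsHom K : Gal(q.SplittingField/L) →* _)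
  refine Group.isSolvable_of_isSolvable_injective (f := f) fun σ τ h => Gal.ext _ fun x hx => ?_
  have hx' : x ∈ p.rootSet q.SplittingField := by
    rw [mem_rootSet'] at hx ⊢
    have hmap : q.map (algebraMap L q.SplittingField) = p.map (algebraMap K q.SplittingField) := by
      rw [IsScalarTower.algebraMap_eq K L, ← Polynomial.map_map]
    rw [← eval_map_algebraMap, hmap, eval_map_algebraMap] at hx
    exact hx
  have h1 := Gal.restrict_smul (p := p) (AlgEquiv.restrictScalarsHom K σ) ⟨x, hx'⟩
  have h2 := Gal.restrict_smul (p := p) (AlgEquiv.restrictScalarsHom K τ) ⟨x, hx'⟩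
  have h3 : Gal.restrict p q.SplittingField (AlgEquiv.restrictScalarsHom K σ) =
    Gal.restrict p q.SplittingField (AlgEquiv.restrictScalarsHom K τ) := h
  rw [h3, h2] at h1
  exact h1.symm

theorem apply_mem_maxSolvableExt {K L E Ω : Type*} [Field K] [Field L] [Field E] [Field Ω]
    [Algebra K L] [Algebra K E] [Algebra L E] [IsScalarTower K L E] [Algebra L Ω] [IsAlgClosed E]
    [IsAlgClosed Ω] (φ : E →ₐ[L] Ω) {x : E} (hx : x ∈ maxSolvableExt K E) :
    φ x ∈ maxSolvableExt L Ω := by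
  obtain ⟨h1, h2⟩ := mem_maxSolvableExt_iff.1 hx
  have h3 : IsSeparable L x := h1.tower_top L
  rw [mem_maxSolvableExt_iff, IsSeparable, minpoly.algHom_eq φ φ.injective]
  refine ⟨h3, ?_⟩
  have hne : (minpoly K x).map (algebraMap K L) ≠ 0 :=
    Polynomial.map_ne_zero (minpoly.ne_zero h1.isIntegral)
  have := isSolvable_gal_map (L := L) _ h2
  exact Group.isSolvable_of_surjective
    (Gal.restrictDvd_surjective (minpoly.dvd_map_of_isScalarTower K L x) hne)

end BaseChange

section Extensions

theorem ValuationSubring.exists_comap_eq {L T : Type*} [Field L] [Field T] (f : L →+* T)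
    (W : ValuationSubring L) : ∃ V : ValuationSubring T, V.comap f = W := by
  obtain ⟨V, hV, hloc⟩ := IsLocalRing.exists_factor_valuationRing (f.comp W.subtype)
  refine ⟨V, le_antisymm (fun x hx => ?_) fun x hx => hV ⟨x, hx⟩⟩
  by_contra hxW
  have hx1 : x⁻¹ ∈ W := (W.mem_or_inv_mem x).resolve_left hxW
  have hx0 : x ≠ 0 := by rintro rfl; exact hxW W.zero_mem
  have hu : IsUnit ((f.comp W.subtype).codRestrict V.toSubring hV ⟨x⁻¹, hx1⟩) := by
    refine IsUnit.of_mul_eq_one ⟨f x, hx⟩ (Subtype.ext ?_)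
    change f x⁻¹ * f x = 1
    rw [← map_mul, inv_mul_cancel₀ hx0, map_one]
  obtain ⟨y, hy⟩ := isUnit_iff_exists_inv.1 (hloc.map_nonunit _ hu)
  have hy' : x⁻¹ * (y : L) = 1 := congrArg Subtype.val hy
  have : x = y := by
    rw [inv_mul_eq_one₀ hx0] at hy'
    exact hy'
  exact hxW (this ▸ y.2)

theorem IsSolvHenselian.existsUnique_comap {L S : Type*} [Field L] [Field S] [Algebra L S]
    {O : ValuationSubring L} (hO : IsSolvHenselian O) (φ : S →ₐ[L] solvClosure L) :
    ∃! W : ValuationSubring S, W.comap (algebraMap L S) = O := by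
  obtain ⟨V, hV, huniq⟩ := hO
  have hcomp (U : ValuationSubring (solvClosure L)) :
      (U.comap φ.toRingHom).comap (algebraMap L S) = U.comap (algebraMap L (solvClosure L)) := by
    rw [ValuationSubring.comap_comap]
    exact congrArg _ φ.comp_algebraMap
  refine ⟨V.comap φ.toRingHom, (hcomp V).trans hV, fun W hW => ?_⟩
  obtain ⟨U, hU⟩ := W.exists_comap_eq φ.toRingHom
  rw [← huniq U (by dsimp only; rw [← hcomp, hU, hW]), hU]

variable {K S : Type*} [Field K] [Field S] [Algebra K S]

theorem ValuationSubring.exists_map_subtype_eq_prod (W : ValuationSubring S) {P : S[X]}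
    (hP : P.Splits) (hm : P.Monic) (hroots : ∀ r ∈ P.roots, r ∈ W) :
    ∃ m : Multiset W, m.map W.subtype = P.roots ∧
      (m.map fun r => X - C r).prod.map W.subtype = P := by
  refine ⟨P.roots.pmap Subtype.mk hroots, ?_, ?_⟩
  · rw [Multiset.map_pmap]
    exact (Multiset.pmap_eq_map _ _ _ _).trans (Multiset.map_id' _)
  · conv_rhs => rw [hP.eq_prod_roots_of_monic hm]
    rw [Polynomial.map_multiset_prod, Multiset.map_map, Multiset.map_pmap]
    simp only [Function.comp_apply, Polynomial.map_sub, map_X, map_C, subtype_apply]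
    exact congrArg _ (Multiset.pmap_eq_map _ _ _ _)

theorem minpoly.exists_algEquiv_of_mem_roots [Normal K S] {x r : S}
    (hr : r ∈ ((minpoly K x).map (algebraMap K S)).roots) : ∃ σ : Gal(S/K), r = σ x := by
  have h := (mem_roots'.1 hr).2
  rw [IsRoot.def, eval_map_algebraMap] at h
  obtain ⟨σ, hσ⟩ := minpoly.exists_algEquiv_of_root' (Normal.isIntegral ‹_› x).isAlgebraic h
  exact ⟨σ, hσ.symm⟩

variable [Normal K S] {W V : ValuationSubring S}

theorem ValuationSubring.algebraMap_coeff_minpoly_mem (hW : ∀ σ : Gal(S/K), ∀ x ∈ W, σ x ∈ W)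
    {x : S} (hx : x ∈ W) (i : ℕ) : algebraMap K S ((minpoly K x).coeff i) ∈ W := by
  obtain ⟨m, -, hm⟩ := W.exists_map_subtype_eq_prod (Normal.splits ‹_› x)
    ((minpoly.monic (Normal.isIntegral ‹Normal K S› x)).map _) fun r hr => by
      obtain ⟨σ, rfl⟩ := minpoly.exists_algEquiv_of_mem_roots hr
      exact hW σ x hx
  rw [← coeff_map, ← hm, coeff_map]
  exact Subtype.prop _

theorem ValuationSubring.valuation_coeff_minpoly_lt_one
    (hW : ∀ σ : Gal(S/K), ∀ x ∈ W, σ x ∈ W) {x : S} (hx : W.valuation x < 1) {i : ℕ}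
    (hi : i < (minpoly K x).natDegree) :
    W.valuation (algebraMap K S ((minpoly K x).coeff i)) < 1 := by
  have hroots (r) (hr : r ∈ ((minpoly K x).map (algebraMap K S)).roots) : W.valuation r < 1 := by
    obtain ⟨σ, rfl⟩ := minpoly.exists_algEquiv_of_mem_roots hr
    exact W.valuation_apply_lt_one hW σ hx
  have hs := Normal.splits ‹_› x
  obtain ⟨m, hm1, hm⟩ := W.exists_map_subtype_eq_prod hs
    ((minpoly.monic (Normal.isIntegral ‹Normal K S› x)).map _) fun r hr =>
      (W.valuation_le_one_iff r).1 (hroots r hr).le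
  rw [← coeff_map, ← hm, coeff_map]
  refine (W.residue_eq_zero_iff _).1 ?_
  have hcard : (minpoly K x).natDegree = m.card := by
    rw [← natDegree_map (algebraMap K S), hs.natDegree_eq_card_roots, ← hm1, Multiset.card_map]
  rw [← coeff_map, Polynomial.map_multiset_prod, Multiset.map_map]
  rw [Multiset.map_congr rfl (g := fun _ => (X : (IsLocalRing.ResidueField W)[X])) fun r hr => ?_]
  · rw [Multiset.map_const', Multiset.prod_replicate, coeff_X_pow, if_neg (hcard ▸ hi).ne]
  · have : IsLocalRing.residue W r = 0 := by
      rw [W.residue_eq_zero_iff]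
      exact hroots r (hm1 ▸ Multiset.mem_map_of_mem W.subtype hr)
    simp [this]

/-- A Galois-invariant valuation ring is the unique extension of its restriction. -/
theorem ValuationSubring.eq_of_comap_eq (hW : ∀ σ : Gal(S/K), ∀ x ∈ W, σ x ∈ W)
    (h : V.comap (algebraMap K S) = W.comap (algebraMap K S)) : V = W := by
  have hle : W ≤ V := fun x hx => by
    by_contra hxV
    rw [← V.valuation_le_one_iff, not_le] at hxV
    have hint := Normal.isIntegral ‹Normal K S› x
    have h1 := minpoly.aeval K x
    rw [aeval_eq_sum_range, Finset.sum_range_succ, (minpoly.monic hint).coeff_natDegree, one_smul,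
      add_comm, add_eq_zero_iff_eq_neg] at h1
    have h2 := congrArg V.valuation h1
    rw [Valuation.map_neg, map_pow] at h2
    refine (Valuation.map_sum_lt V.valuation (g := V.valuation x ^ (minpoly K x).natDegree)
      ?_ fun i hi => ?_).ne h2.symm
    · exact pow_ne_zero _ (zero_lt_one.trans hxV).ne'
    · have h3 : (minpoly K x).coeff i ∈ V.comap (algebraMap K S) := by
        rw [h]
        exact algebraMap_coeff_minpoly_mem hW hx i
      rw [Algebra.smul_def, map_mul, map_pow]
      exact (mul_le_of_le_one_left zero_le ((V.valuation_le_one_iff _).2 h3)).trans_lt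
        (pow_lt_pow_right₀ hxV (Finset.mem_range.1 hi))
  refine le_antisymm (fun x hx => ?_) hle
  by_contra hxW
  have hx0 : x ≠ 0 := by rintro rfl; exact hxW W.zero_mem
  set y := x⁻¹ with hy
  have hyW : W.valuation y < 1 := by
    rw [valuation_lt_one_iff_inv, hy, inv_inv]
    exact Or.inr hxW
  have hyV : V.valuation y = 1 := by
    refine le_antisymm ((V.valuation_le_one_iff _).2
      (hle ((W.valuation_le_one_iff _).1 hyW.le))) (not_lt.1 fun h1 => ?_)
    rw [valuation_lt_one_iff_inv, hy, inv_inv] at h1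
    exact h1.elim (inv_ne_zero hx0) (fun h2 => h2 hx)
  have hint := Normal.isIntegral ‹Normal K S› y
  have h1 := minpoly.aeval K y
  rw [aeval_eq_sum_range, Finset.sum_range_succ, (minpoly.monic hint).coeff_natDegree, one_smul,
    add_comm, add_eq_zero_iff_eq_neg] at h1
  have h2 := congrArg V.valuation h1
  rw [Valuation.map_neg, map_pow, hyV, one_pow] at h2
  refine (Valuation.map_sum_lt V.valuation one_ne_zero fun i hi => ?_).ne h2.symm
  rw [Algebra.smul_def, map_mul, map_pow, hyV, one_pow, mul_one, ← valuation_comap_lt_one_iff, h,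
    valuation_comap_lt_one_iff]
  exact valuation_coeff_minpoly_lt_one hW hyW (Finset.mem_range.1 hi)

end Extensions

section Invariance

theorem AlgEquiv.exists_pow_succ_apply_eq {K L : Type*} [Field K] [Field L] [Algebra K L]
    [Algebra.IsAlgebraic K L] (ρ : Gal(L/K)) (x : L) : ∃ n : ℕ, (ρ ^ (n + 1)) x = x := by
  have hfin : ((minpoly K x).rootSet L).Finite := rootSet_finite _ _
  obtain ⟨m, n, hlt, h⟩ := hfin.exists_lt_map_eq_of_forall_mem (f := fun n : ℕ => (ρ ^ n) x)
    fun n => by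
      rw [mem_rootSet_of_ne (minpoly.ne_zero (Algebra.IsIntegral.isIntegral x)), aeval_algHom_apply,
        minpoly.aeval, map_zero]
  obtain ⟨d, rfl⟩ := Nat.exists_eq_add_of_lt hlt
  refine ⟨d, (ρ ^ m).injective ?_⟩
  rw [← AlgEquiv.mul_apply, ← pow_add]
  exact h.symm

theorem ValuationSubring.comap_algEquiv_eq_of_le_or_le {K L : Type*} [Field K] [Field L]
    [Algebra K L] [Algebra.IsAlgebraic K L] (ρ : Gal(L/K)) {O : ValuationSubring L}
    (h : (∀ x ∈ O, ρ x ∈ O) ∨ ∀ x, ρ x ∈ O → x ∈ O) (x : L) : ρ x ∈ O ↔ x ∈ O := by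
  obtain ⟨n, hn⟩ := ρ.exists_pow_succ_apply_eq x
  rcases h with h | h
  · refine ⟨fun hx => ?_, h x⟩
    have (k : ℕ) : (ρ ^ (k + 1)) x ∈ O := by
      induction k with
      | zero => simpa using hx
      | succ k ih =>
        rw [pow_succ', AlgEquiv.mul_apply]
        exact h _ ih
    exact hn ▸ this n
  · refine ⟨fun hx => h x hx, fun hx => ?_⟩
    have (k : ℕ) (hk : (ρ ^ (k + 1)) x ∈ O) : ρ x ∈ O := by
      induction k with
      | zero => simpa using hk
      | succ k ih =>
        rw [pow_succ', AlgEquiv.mul_apply] at hk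
        exact ih (h _ hk)
    exact this n (hn.symm ▸ hx)

variable {K L S : Type*} [Field K] [Field L] [Field S] [Algebra K L] [Algebra K S] [Algebra L S]
  [IsScalarTower K L S] [Normal K L]

/-- The conjugate of an automorphism over a normal subextension. -/
def conjGal (τ : Gal(S/K)) (σ : Gal(S/L)) : Gal(S/L) :=
  AlgEquiv.ofRingEquiv (f := (τ * σ.restrictScalars K * τ⁻¹ : Gal(S/K)).toRingEquiv) fun x => by
    change τ (σ (τ⁻¹ (algebraMap L S x))) = _
    rw [← AlgEquiv.restrictNormal_commutes, σ.commutes, AlgEquiv.restrictNormal_commutes]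
    exact τ.apply_symm_apply _

theorem conjGal_apply_apply (τ : Gal(S/K)) (σ : Gal(S/L)) (x : S) :
    conjGal τ σ (τ x) = τ (σ x) :=
  congrArg (fun y => τ (σ y)) (τ.symm_apply_apply x)

/-- A valuation ring of `S` that is the only extension of its restriction to `L`, and whose
restriction to `L` has a residue field that is not radically closed, is `Gal(S/K)`-invariant. -/
theorem ValuationSubring.apply_mem_of_not_isRadicalClosed [IsGalois L S]
    (hsplit : ∀ p : ℕ, p.Prime → (p : S) ≠ 0 → ∀ a : S, (X ^ p - C a).Splits)
    (hsplit' : ∀ p : ℕ, p.Prime → (p : S) = 0 → ∀ a : S, (X ^ p - X - C a).Splits)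
    {W : ValuationSubring S}
    (huniq : ∀ V : ValuationSubring S,
      V.comap (algebraMap L S) = W.comap (algebraMap L S) → V = W)
    (hres : ¬ IsRadicalClosed (IsLocalRing.ResidueField (W.comap (algebraMap L S))))
    (τ : Gal(S/K)) {x : S} (hx : x ∈ W) : τ x ∈ W := by
  by_contra hτ
  have hW (σ : Gal(S/L)) (y : S) (hy : y ∈ W) : σ y ∈ W := by
    have : W.comap (σ : S →+* S) = W := huniq _ (by
      ext y
      rw [mem_comap, mem_comap, mem_comap]
      exact iff_of_eq (congrArg (· ∈ W) (σ.commutes y)))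
    rw [← this] at hy
    exact hy
  set ρ := τ.restrictNormal L with hρ
  have hcomm (y : L) : τ (algebraMap L S y) = algebraMap L S (ρ y) :=
    (AlgEquiv.restrictNormal_commutes τ L y).symm
  let W' := W.comap (τ : S →+* S)
  have hmem (y : S) : y ∈ W' ↔ τ y ∈ W := Iff.rfl
  have hW' (σ : Gal(S/L)) (y : S) (hy : y ∈ W') : σ y ∈ W' := by
    rw [hmem, ← conjGal_apply_apply]
    exact hW _ _ hy
  have hne : ¬ ∀ y : L, ρ y ∈ W.comap (algebraMap L S) ↔ y ∈ W.comap (algebraMap L S) := by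
    intro h
    have : W' = W := huniq _ (by
      ext y
      rw [mem_comap, hmem, hcomm]
      exact h y)
    rw [← hmem, this] at hτ
    exact hτ hx
  have : Algebra.IsAlgebraic K L := Normal.toIsAlgebraic
  have h1 := mt (comap_algEquiv_eq_of_le_or_le ρ (O := W.comap (algebraMap L S))) hne
  push Not at h1
  obtain ⟨⟨a, ha, ha'⟩, b, hb', hb⟩ := h1
  rw [mem_comap, ← hcomm, ← hmem, ← valuation_le_one_iff, not_le] at ha'
  rw [mem_comap, ← hcomm, ← hmem, ← valuation_le_one_iff] at hb'
  rw [mem_comap, ← valuation_le_one_iff] at ha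
  rw [mem_comap, ← valuation_le_one_iff, not_le] at hb
  refine hres (isRadicalClosed_residueField_comap W W' hW' (z := a / b) ?_ ?_ (fun p => ?_)
    hsplit hsplit')
  · rw [map_div₀, map_div₀, div_lt_one₀ (zero_lt_one.trans hb)]
    exact ha.trans_lt hb
  · have hb0 : 0 < W'.valuation (algebraMap L S b) := by
      rw [Valuation.pos_iff, map_ne_zero_iff _ (algebraMap L S).injective]
      rintro rfl
      simp at hb
    rw [map_div₀, map_div₀, one_lt_div₀ hb0]
    exact hb'.trans_lt ha'
  · rw [valuation_comap_lt_one_iff]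
    exact iff_of_eq (congrArg (W.valuation · < 1) (map_natCast τ p).symm)

end Invariance

section Residue

theorem IsSolvClosed.exists_algebraMap_eq_pow {k k₁ : Type*} [Field k] [Field k₁] [Algebra k k₁]
    [Normal k k₁] (hk : IsSolvClosed k) (hsol : Group.IsSolvable Gal(k₁/k)) (x : k₁) :
    ∃ n : ℕ, ∃ c : k, algebraMap k k₁ c = x ^ ringExpChar k ^ n := by
  have : Algebra.IsAlgebraic k k₁ := Normal.toIsAlgebraic
  obtain ⟨n, y, hy⟩ := IsPurelyInseparable.pow_mem (separableClosure k k₁) (ringExpChar k) x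
  have hsep : IsSeparable k (x ^ ringExpChar k ^ n) := hy ▸ y.2
  obtain ⟨c, hc⟩ := hk.mem_range hsep (isSolvable_gal_minpoly_of_normal hsol _)
  exact ⟨n, c, hc⟩

variable {K N : Type*} [Field K] [Field N] [Algebra K N]

theorem ValuationSubring.exists_valuation_pow_sub_lt_one [FiniteDimensional K N] [IsGalois K N]
    (hsol : Group.IsSolvable Gal(N/K)) {W : ValuationSubring N}
    (hW : ∀ σ : Gal(N/K), ∀ x ∈ W, σ x ∈ W)
    (hk : IsSolvClosed (IsLocalRing.ResidueField (W.comap (algebraMap K N)))) {b : N}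
    (hb : b ∈ W) :
    ∃ n : ℕ, ∃ d ∈ W.comap (algebraMap K N), W.valuation
      (b ^ ringExpChar (IsLocalRing.ResidueField (W.comap (algebraMap K N))) ^ n -
        algebraMap K N d) < 1 := by
  set O := W.comap (algebraMap K N) with hO
  let f : O →+* W := ((algebraMap K N).comp O.subtype).codRestrict W.toSubring fun x => x.2
  let : Algebra O W := f.toAlgebra
  let : MulSemiringAction Gal(N/K) W :=
    { smul := fun σ x => ⟨σ x, hW σ x x.2⟩
      one_smul := fun _ => rfl
      mul_smul := fun _ _ _ => rfl
      smul_zero := fun σ => Subtype.ext (map_zero σ)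
      smul_add := fun σ x y => Subtype.ext (map_add σ _ _)
      smul_one := fun σ => Subtype.ext (map_one σ)
      smul_mul := fun σ x y => Subtype.ext (map_mul σ _ _) }
  have : SMulCommClass Gal(N/K) O W := ⟨fun σ x y => by
    refine Subtype.ext ?_
    rw [Algebra.smul_def, Algebra.smul_def]
    change σ (algebraMap K N x * y) = algebraMap K N x * σ y
    rw [map_mul, σ.commutes]⟩
  have : Algebra.IsInvariant O W Gal(N/K) := ⟨fun x hx => by
    obtain ⟨c, hc⟩ := (IsGalois.mem_range_algebraMap_iff_fixed (F := K) (x : N)).2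
      fun σ => congrArg Subtype.val (hx σ)
    exact ⟨⟨c, by rw [hO, mem_comap, hc]; exact x.2⟩, Subtype.ext hc⟩⟩
  let P := IsLocalRing.maximalIdeal O
  let Q := IsLocalRing.maximalIdeal W
  let : Field (O ⧸ P) := Ideal.Quotient.field P
  let : Field (W ⧸ Q) := Ideal.Quotient.field Q
  have : Q.LiesOver P := ⟨by
    ext x
    exact (O.valuation_lt_one_iff x).trans ((W.valuation_comap_lt_one_iff _ _).trans
      (W.valuation_lt_one_iff (f x)).symm)⟩
  have : Normal (O ⧸ P) (W ⧸ Q) := Ideal.Quotient.normal Gal(N/K) P Q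
  have hsol' : Group.IsSolvable Gal((W ⧸ Q)/(O ⧸ P)) :=
    Group.isSolvable_of_surjective (Ideal.Quotient.stabilizerHom_surjective Gal(N/K) P Q)
  have hk' : IsSolvClosed (O ⧸ P) := hk
  obtain ⟨n, c, hc⟩ := hk'.exists_algebraMap_eq_pow hsol' (Ideal.Quotient.mk Q ⟨b, hb⟩)
  obtain ⟨d, rfl⟩ := Ideal.Quotient.mk_surjective c
  refine ⟨n, d, d.2, ?_⟩
  exact (W.residue_eq_iff (⟨b, hb⟩ ^ _) (f d)).1 (((map_pow _ _ _).trans hc.symm))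

theorem ValuationSubring.apply_mem_comap_of_forall {S : Type*} [Field S] [Algebra K S]
    [Algebra N S] [IsScalarTower K N S] [Normal K S] [Normal K N] {W : ValuationSubring S}
    (hW : ∀ σ : Gal(S/K), ∀ x ∈ W, σ x ∈ W) (σ : Gal(N/K)) (x : N)
    (hx : x ∈ W.comap (algebraMap N S)) : σ x ∈ W.comap (algebraMap N S) := by
  have := hW (σ.liftNormal S) _ hx
  rwa [AlgEquiv.liftNormal_commutes] at this

theorem IsRadicalClosed.of_exists_pow {k k₁ : Type*} [Field k] [Field k₁] (f : k →+* k₁)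
    (h : ∀ x : k₁, ∃ n : ℕ, ∃ c : k, f c = x ^ ringExpChar k ^ n) (hk : IsRadicalClosed k) :
    IsRadicalClosed k₁ := by
  refine fun p hp => ⟨fun h0 a => ?_, fun h0 a => ?_⟩
  · obtain ⟨n, c, hc⟩ := h a
    have h0' : (p : k) ≠ 0 := fun h1 => h0 (by rw [← map_natCast f, h1, map_zero])
    obtain ⟨d, rfl⟩ := (hk p hp).1 h0' c
    rcases eq_or_ne a 0 with rfl | ha
    · exact ⟨0, zero_pow hp.ne_zero⟩
    have hcop : p.Coprime (ringExpChar k ^ n) := by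
      refine Nat.Coprime.pow_right n ((Nat.Prime.coprime_iff_not_dvd hp).2 fun h1 => h0' ?_)
      have hq := ringExpChar.expChar k
      generalize ringExpChar k = q at hq h1
      obtain _ | hq' := hq
      · exact absurd (Nat.dvd_one.1 h1) hp.ne_one
      · rw [(Nat.prime_dvd_prime_iff_eq hp hq').1 h1, CharP.cast_eq_zero]
    have hbez := Nat.gcd_eq_gcd_ab p (ringExpChar k ^ n)
    rw [hcop] at hbez
    generalize ringExpChar k ^ n = m at *
    refine ⟨a ^ p.gcdA m * f d ^ p.gcdB m, ?_⟩
    rw [mul_pow, ← zpow_natCast, ← zpow_natCast, ← zpow_mul, ← zpow_mul, mul_comm (p.gcdB m),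
      zpow_mul (f d), zpow_natCast, ← _root_.map_pow, hc, ← zpow_natCast, ← zpow_mul,
      ← zpow_add₀ ha, mul_comm (p.gcdA m), ← hbez, Nat.cast_one, zpow_one]
  · have h0' : (p : k) = 0 := f.injective (by rw [map_natCast, h0, map_zero])
    have hchar : ringExpChar k = p := by
      have : CharP k p := (CharP.charP_iff_prime_eq_zero hp).2 h0'
      have : ExpChar k p := .prime hp
      exact ringExpChar.eq k p
    obtain ⟨n, c, hc⟩ := h a
    rw [hchar] at hc
    clear h
    induction n generalizing a c with
    | zero =>
      obtain ⟨d, rfl⟩ := (hk p hp).2 h0' c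
      exact ⟨f d, by rw [← _root_.map_pow, ← map_sub, hc, pow_zero, pow_one]⟩
    | succ n ih =>
      obtain ⟨d, hd⟩ := ih (a ^ p) c (by rw [hc, ← pow_mul, pow_succ'])
      refine ⟨d - a, ?_⟩
      rw [sub_pow_of_natCast_eq_zero hp h0]
      linear_combination hd

end Residue

section Restriction

variable {K : Type*} [Field K]

/-- If a Galois-invariant valuation ring of `K^solv` induces a solv-closed residue field on `K`,
then it induces a radically closed residue field on every subextension. -/
theorem isRadicalClosed_residueField_comap_of_isSolvClosed {L : Type*} [Field L] [Algebra K L]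
    [Algebra L (solvClosure K)] [IsScalarTower K L (solvClosure K)]
    {W : ValuationSubring (solvClosure K)}
    (hW : ∀ σ : Gal(solvClosure K/K), ∀ x ∈ W, σ x ∈ W)
    (hk : IsSolvClosed (IsLocalRing.ResidueField (W.comap (algebraMap K (solvClosure K))))) :
    IsRadicalClosed (IsLocalRing.ResidueField (W.comap (algebraMap L (solvClosure K)))) := by
  set O := W.comap (algebraMap K (solvClosure K)) with hO
  set O' := W.comap (algebraMap L (solvClosure K)) with hO'
  have hmem (x : K) : algebraMap K L x ∈ O' ↔ x ∈ O := by
    rw [hO', hO, ValuationSubring.mem_comap, ValuationSubring.mem_comap,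
      ← IsScalarTower.algebraMap_apply]
  let f : O →+* O' := ((algebraMap K L).comp O.subtype).codRestrict O'.toSubring
    fun x => (hmem x).2 x.2
  have : IsLocalHom f := ⟨fun x hx => by
    replace hx := (O'.valuation_eq_one_iff (f x)).1 hx
    refine (O.valuation_eq_one_iff x).2
      (le_antisymm ((O.valuation_le_one_iff _).2 x.2) (not_lt.1 fun h => hx.not_lt ?_))
    replace h := (W.valuation_comap_lt_one_iff _ _).1 h
    rw [IsScalarTower.algebraMap_apply K L] at h
    exact (W.valuation_comap_lt_one_iff (algebraMap L (solvClosure K)) _).2 h⟩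
  refine hk.isRadicalClosed.of_exists_pow (IsLocalRing.ResidueField.map f) fun x => ?_
  obtain ⟨⟨b, hb⟩, rfl⟩ := IsLocalRing.residue_surjective x
  obtain ⟨M, hM, hbM⟩ := exists_finite_of_mem_maxSolvableExt (algebraMap L (solvClosure K) b).2
  have ⟨_, _, hsol⟩ := hM
  let : Algebra M (solvClosure K) :=
    (IntermediateField.inclusion (IsFiniteSolvable.le_maxSolvableExt hM)).toAlgebra
  have : IsScalarTower K M (solvClosure K) := IsScalarTower.of_algebraMap_eq fun _ => rfl
  have hc : (W.comap (algebraMap M (solvClosure K))).comap (algebraMap K M) = O := by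
    rw [ValuationSubring.comap_comap, ← IsScalarTower.algebraMap_eq]
  obtain ⟨n, d, hd, h⟩ := ValuationSubring.exists_valuation_pow_sub_lt_one hsol
    (W := W.comap (algebraMap M (solvClosure K)))
    (ValuationSubring.apply_mem_comap_of_forall hW) (hc.symm ▸ hk) (b := ⟨_, hbM⟩) hb
  rw [hc] at hd h
  refine ⟨n, IsLocalRing.residue O ⟨d, hd⟩, ?_⟩
  rw [IsLocalRing.ResidueField.map_residue, ← _root_.map_pow]
  refine (O'.residue_eq_iff (f ⟨d, hd⟩) (⟨b, hb⟩ ^ _)).2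
    ((W.valuation_comap_lt_one_iff (algebraMap L (solvClosure K)) (algebraMap K L d - b ^ _)).2 ?_)
  rw [ValuationSubring.valuation_comap_lt_one_iff, map_sub, _root_.map_pow,
    ← IsScalarTower.algebraMap_apply] at h
  rw [map_sub, _root_.map_pow, ← IsScalarTower.algebraMap_apply, Valuation.map_sub_swap]
  exact h

/-- The maximal solvable extension of `K` embeds over `L` into that of `L`. -/
theorem nonempty_algHom_solvClosure (L E : Type*) [Field L] [Field E] [Algebra K L] [Algebra K E]
    [Algebra L E] [IsScalarTower K L E] [IsAlgClosed E] [Algebra.IsAlgebraic K E]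
    [Algebra L (maxSolvableExt K E)] [IsScalarTower L (maxSolvableExt K E) E] :
    Nonempty (maxSolvableExt K E →ₐ[L] solvClosure L) := by
  have : Algebra.IsAlgebraic L E := Algebra.IsAlgebraic.tower_top (K := K) L
  let φ : E →ₐ[L] AlgebraicClosure L := IsAlgClosed.lift
  exact ⟨(φ.comp (IsScalarTower.toAlgHom L (maxSolvableExt K E) E)).codRestrict
    (solvClosure L).toSubalgebra fun x => apply_mem_maxSolvableExt (K := K) φ x.2⟩

end Restriction

/-- Let `L ⊆ K^solv` be normal over `K`. If `O'` is a solv-henselian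
valuation ring of `L` with non-solv-closed residue field, then `O' ∩ K` is a solv-henselian
valuation ring of `K` with non-solv-closed residue field. -/
theorem statement_15 (K : Type) [Field K]
    (L : IntermediateField K (AlgebraicClosure K)) (hL : L ≤ solvClosure K)
    (hnorm : Normal K ↥L)
    (O' : ValuationSubring ↥L) (h1 : IsSolvHenselian O')
    (h2 : ¬ IsSolvClosed (IsLocalRing.ResidueField ↥O')) :
    IsSolvHenselian (O'.comap (algebraMap K ↥L)) ∧
    ¬ IsSolvClosed (IsLocalRing.ResidueField ↥(O'.comap (algebraMap K ↥L))) := by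
  let : Algebra L (solvClosure K) := (IntermediateField.inclusion hL).toAlgebra
  have : IsScalarTower K L (solvClosure K) := IsScalarTower.of_algebraMap_eq fun _ => rfl
  have : IsGalois L (solvClosure K) := IsGalois.tower_top_of_isGalois K L _
  have : IsScalarTower L (solvClosure K) (AlgebraicClosure K) :=
    IsScalarTower.of_algebraMap_eq fun _ => rfl
  obtain ⟨φ⟩ := nonempty_algHom_solvClosure (K := K) L (AlgebraicClosure K)
  obtain ⟨W, rfl, huniq⟩ := h1.existsUnique_comap φ
  have hW (σ : Gal(solvClosure K/K)) (x) (hx : x ∈ W) : σ x ∈ W :=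
    ValuationSubring.apply_mem_of_not_isRadicalClosed (L := L)
      (fun p _ h0 a => splits_X_pow_sub_C_maxSolvableExt
        (fun h => h0 (by rw [← map_natCast (algebraMap K _), h, map_zero])) a)
      (fun p hp h0 a => splits_X_pow_sub_X_sub_C_maxSolvableExt hp
        ((algebraMap K (solvClosure K)).injective (by rw [map_natCast, h0, map_zero])) a)
      huniq (fun h => h2 h.isSolvClosed) σ hx
  rw [ValuationSubring.comap_comap, ← IsScalarTower.algebraMap_eq]
  exact ⟨⟨W, rfl, fun V hV => ValuationSubring.eq_of_comap_eq hW hV⟩, fun hk =>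
    h2 (isRadicalClosed_residueField_comap_of_isSolvClosed hW hk).isSolvClosed⟩
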